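/- arXiv:0704.3937 — 3 statements merged into one kernel-verified Lean document; each statement's English description precedes it below -/
import Mathlib

section
/- There exists a sequence (p_n) with p_n ∈ (0,1) such that the L^q-spectrum τ_μ of the associated inhomogeneous Bernoulli product μ fails to be differentiable at every point of some subset of (1,∞) that is dense in (1,∞); i.e., μ has a dense set of phase transitions. -/
open MeasureTheory Filter Set

noncomputable section

/-- The generation-`n` cylinder `I_{ε₁…εₙ} = {x ∈ Σ : x₁ = ε₁, …, xₙ = εₙ}`; the
collection `F_n` of all `2^n` cylinders of generation `n` is the range of
`ε ↦ cyl ε` over `ε : Fin n → Bool`. -/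
def cyl {n : ℕ} (ε : Fin n → Bool) : Set (ℕ → Bool) :=
  {x | ∀ i : Fin n, x (i : ℕ) = ε i}

/-- `μ` is the inhomogeneous Bernoulli product with weights `(pₙ)`: the Borel
probability measure determined by `μ(I_{ε₁…εₙ}) = ∏_{j=1}^n pⱼ^{1-εⱼ} (1-pⱼ)^{εⱼ}`. -/
def IsBernoulliProduct (p : ℕ → ℝ) (μ : Measure (ℕ → Bool)) : Prop :=
  IsProbabilityMeasure μ ∧
    ∀ (n : ℕ) (ε : Fin n → Bool),
      μ (cyl ε) = ENNReal.ofReal (∏ i : Fin n, if ε i then 1 - p (i : ℕ) else p (i : ℕ))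

/-- `τ_{μ,n}(q) = (1/(n log 2)) · log ∑_{I ∈ F_n} μ(I)^q`. -/
def tauN (μ : Measure (ℕ → Bool)) (n : ℕ) (q : ℝ) : ℝ :=
  (1 / (n * Real.log 2)) * Real.log (∑ ε : Fin n → Bool, (μ (cyl ε)).toReal ^ q)

/-- The `L^q`-spectrum `τ_μ(q) = limsup_{n→∞} τ_{μ,n}(q)`. -/
def tauLq (μ : Measure (ℕ → Bool)) (q : ℝ) : ℝ :=
  limsup (fun n : ℕ => tauN μ n q) atTop


lemma aux_bits (s : ℕ → ℝ) (hs : ∀ j, 0 ≤ s j ∧ s j ≤ 1) :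
    ∃ c : ℕ → ℝ, (∀ j, c j = 0 ∨ c j = 1) ∧ (∀ j, s j = 0 → c j = 0) ∧
      ∀ n, |(∑ j ∈ Finset.range n, c j) - ∑ j ∈ Finset.range n, s j| ≤ 1 := by
  set S : ℕ → ℝ := fun n => ∑ j ∈ Finset.range n, s j with hS
  have hS1 : ∀ j, S (j+1) = S j + s j := fun j => Finset.sum_range_succ _ _
  refine ⟨fun j => ((⌊S (j+1)⌋ - ⌊S j⌋ : ℤ) : ℝ), ?_, ?_, ?_⟩
  · intro j
    have h1 : ⌊S j⌋ ≤ ⌊S (j+1)⌋ := Int.floor_le_floor (by rw [hS1]; linarith [(hs j).1])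
    have h2 : ⌊S (j+1)⌋ ≤ ⌊S j⌋ + 1 := by
      rw [← Int.floor_add_one]
      exact Int.floor_le_floor (by rw [hS1]; linarith [(hs j).2])
    have : ⌊S (j+1)⌋ - ⌊S j⌋ = 0 ∨ ⌊S (j+1)⌋ - ⌊S j⌋ = 1 := by omega
    rcases this with h | h
    · left; simp only [h]; simp
    · right; simp only [h]; simp
  · intro j hj
    simp only [hS1, hj]; simp
  · intro n
    have : ∑ j ∈ Finset.range n, ((⌊S (j+1)⌋ - ⌊S j⌋ : ℤ) : ℝ) = ⌊S n⌋ := by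
      push_cast
      rw [Finset.sum_range_sub (fun j => (⌊S j⌋ : ℝ))]
      simp [hS]
    rw [this, abs_le]
    constructor
    · linarith [Int.lt_floor_add_one (S n)]
    · linarith [Int.floor_le (S n)]

lemma aux_cesaro (α w : ℕ → ℝ) (hw : ∀ j, 0 ≤ w j ∧ w j ≤ 1)
    (hα : Tendsto (fun n : ℕ => ((n : ℝ) + 1) * |α (n+1) - α n|) atTop (nhds 0)) :
    Tendsto (fun n : ℕ => (n : ℝ)⁻¹ * (α n * (∑ j ∈ Finset.range n, w j) -
      ∑ j ∈ Finset.range n, w j * α j)) atTop (nhds 0) := by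
  have hW : ∀ n : ℕ, |∑ j ∈ Finset.range n, w j| ≤ n := by
    intro n
    rw [abs_of_nonneg (Finset.sum_nonneg fun j _ => (hw j).1)]
    calc _ ≤ ∑ j ∈ Finset.range n, (1:ℝ) := Finset.sum_le_sum fun j _ => (hw j).2
      _ = n := by simp
  have key : ∀ n : ℕ, (α n * (∑ j ∈ Finset.range n, w j) -
      ∑ j ∈ Finset.range n, w j * α j) =
      ∑ j ∈ Finset.range n, (∑ i ∈ Finset.range (j+1), w i) * (α (j+1) - α j) := by
    intro n
    induction n with
    | zero => simp
    | succ n ih =>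
      rw [Finset.sum_range_succ (fun j => (∑ i ∈ Finset.range (j+1), w i) * (α (j+1) - α j)), ← ih,
        Finset.sum_range_succ w, Finset.sum_range_succ (fun j => w j * α j)]
      ring
  simp_rw [key]
  apply Filter.Tendsto.cesaro
  refine squeeze_zero_norm (fun n => ?_) hα
  rw [Real.norm_eq_abs, abs_mul]
  refine mul_le_mul_of_nonneg_right ?_ (abs_nonneg _)
  exact_mod_cast hW (n+1)

lemma aux_comb (α w : ℕ → ℝ) (h01 : ∀ j, 0 ≤ α j ∧ α j ≤ 1) (hw : ∀ j, w j = 0 ∨ w j = 1)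
    (hα : Tendsto (fun n : ℕ => ((n : ℝ) + 1) * |α (n+1) - α n|) atTop (nhds 0))
    (hW : ∀ n : ℕ, |(∑ j ∈ Finset.range n, w j) - n / 2| ≤ 1) :
    ∃ c : ℕ → ℝ, (∀ j, c j = 0 ∨ c j = 1) ∧ (∀ j, w j = 0 → c j = 0) ∧
      Tendsto (fun n : ℕ => (n : ℝ)⁻¹ * (∑ j ∈ Finset.range n, c j) - α n / 2) atTop (nhds 0) := by
  have hw' : ∀ j, 0 ≤ w j ∧ w j ≤ 1 := by
    intro j; rcases hw j with h | h <;> simp [h]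
  obtain ⟨c, hc1, hc2, hc3⟩ := aux_bits (fun j => w j * α j) (fun j => ⟨mul_nonneg (hw' j).1 (h01 j).1,
    mul_le_one₀ (hw' j).2 (h01 j).1 (h01 j).2⟩)
  refine ⟨c, hc1, fun j hj => hc2 j (by simp [hj]), ?_⟩
  have h1 := aux_cesaro α w hw' hα
  have hinv : Tendsto (fun n : ℕ => (n : ℝ)⁻¹) atTop (nhds 0) := tendsto_inv_atTop_nhds_zero_nat
  have h2 : Tendsto (fun n : ℕ => (n : ℝ)⁻¹ * ((∑ j ∈ Finset.range n, c j) -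
      ∑ j ∈ Finset.range n, w j * α j)) atTop (nhds 0) := by
    refine squeeze_zero_norm (fun n => ?_) hinv
    rw [norm_mul, Real.norm_eq_abs, Real.norm_eq_abs, abs_of_nonneg (by positivity)]
    exact mul_le_of_le_one_right (by positivity) (hc3 n)
  have h3 : Tendsto (fun n : ℕ => (n : ℝ)⁻¹ * (α n * ((∑ j ∈ Finset.range n, w j) - n/2)))
      atTop (nhds 0) := by
    refine squeeze_zero_norm (fun n => ?_) hinv
    rw [norm_mul, Real.norm_eq_abs, Real.norm_eq_abs, abs_of_nonneg (by positivity), abs_mul]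
    refine mul_le_of_le_one_right (by positivity) (mul_le_one₀ ?_ (abs_nonneg _) (hW n))
    rw [abs_of_nonneg (h01 n).1]; exact (h01 n).2
  have h4 := (h2.sub h1).add h3
  simp only [sub_zero, add_zero] at h4
  refine h4.congr' ?_
  filter_upwards [eventually_gt_atTop 0] with n hn
  have : (n:ℝ) ≠ 0 := by positivity
  field_simp
  ring

/-- slow phase -/
def theta (x : ℝ) : ℝ := Real.log (1 + Real.log (1 + x))

lemma theta_le {x y : ℝ} (hx : 0 ≤ x) (hxy : x ≤ y) :
    |theta y - theta x| ≤ (y - x) / (1 + x) / (1 + Real.log (1 + x)) := by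
  have hlx : 0 ≤ Real.log (1 + x) := Real.log_nonneg (by linarith)
  have hl : Real.log (1+x) ≤ Real.log (1+y) := Real.log_le_log (by linarith) (by linarith)
  have gen : ∀ a b : ℝ, 0 < a → a ≤ b → Real.log b - Real.log a ≤ (b - a) / a := by
    intro a b ha hab
    rw [← Real.log_div (by linarith) (by linarith)]
    have := Real.log_le_sub_one_of_pos (show 0 < b / a by have : 0 < b := by linarith
                                                          positivity)
    rw [sub_div, div_self ha.ne']; exact this
  have h2 : theta x ≤ theta y := Real.log_le_log (by linarith) (by linarith)
  rw [abs_of_nonneg (by linarith)]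
  refine (gen _ _ (by linarith) (by linarith)).trans ?_
  refine div_le_div_of_nonneg_right ?_ (by linarith)
  have := gen (1+x) (1+y) (by linarith) (by linarith)
  ring_nf at this ⊢
  linarith

lemma sin_slow : Tendsto (fun n : ℕ => ((n : ℝ) + 1) *
    |Real.sin (theta ((n+1 : ℕ) : ℝ)) - Real.sin (theta n)|) atTop (nhds 0) := by
  have h1 : Tendsto (fun n : ℕ => (1 + Real.log (1 + (n:ℝ)))⁻¹) atTop (nhds 0) := by
    apply Tendsto.inv_tendsto_atTop
    apply tendsto_atTop_add_const_left
    exact Real.tendsto_log_atTop.comp (tendsto_atTop_add_const_left _ _ tendsto_natCast_atTop_atTop)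
  refine squeeze_zero (fun n => by positivity) (fun n => ?_) h1
  have hn : (0:ℝ) ≤ n := by positivity
  have h2 := theta_le (x := n) (y := ((n+1:ℕ):ℝ)) (by positivity) (by push_cast; linarith)
  have h3 : |Real.sin (theta ((n+1 : ℕ) : ℝ)) - Real.sin (theta n)| ≤ |theta ((n+1 : ℕ) : ℝ) - theta n| := by
    have := Real.lipschitzWith_sin.dist_le_mul (theta ((n+1 : ℕ) : ℝ)) (theta n)
    simpa [Real.dist_eq] using this
  calc _ ≤ ((n:ℝ)+1) * ((((n+1:ℕ):ℝ) - n) / (1 + n) / (1 + Real.log (1 + n))) := by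
        gcongr; exact h3.trans h2
    _ = _ := by push_cast; field_simp; ring

lemma sin_freq (s : ℝ) (hs : s ∈ Icc (-1:ℝ) 1) (ε : ℝ) (hε : 0 < ε) :
    ∃ᶠ n : ℕ in atTop, |Real.sin (theta n) - s| < ε := by
  rw [frequently_atTop]
  intro N
  set t := Real.arcsin s
  have hT : Tendsto (fun k : ℕ => Real.exp (Real.exp (t + k * (2 * Real.pi)) - 1) - 1) atTop atTop := by
    apply tendsto_atTop_add_const_right
    apply Real.tendsto_exp_atTop.comp
    apply tendsto_atTop_add_const_right
    apply Real.tendsto_exp_atTop.comp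
    apply tendsto_atTop_add_const_left
    exact tendsto_natCast_atTop_atTop.atTop_mul_const (by positivity)
  obtain ⟨k, hk⟩ := (hT.eventually_ge_atTop (max N (2/ε))).exists
  set x := Real.exp (Real.exp (t + k * (2 * Real.pi)) - 1) - 1 with hx
  have hxN : (N:ℝ) ≤ x := (le_max_left _ _).trans hk
  have hxe : 2 / ε ≤ x := (le_max_right _ _).trans hk
  have hx0 : 0 ≤ x := le_trans (by positivity) hxN
  refine ⟨⌈x⌉₊, by exact_mod_cast hxN.trans (Nat.le_ceil x), ?_⟩
  have hth : theta x = t + k * (2 * Real.pi) := by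
    simp [theta, hx]
  have h2 := theta_le hx0 (Nat.le_ceil x)
  have h3 : |Real.sin (theta (⌈x⌉₊ : ℝ)) - Real.sin (theta x)| ≤ |theta (⌈x⌉₊ : ℝ) - theta x| := by
    have := Real.lipschitzWith_sin.dist_le_mul (theta (⌈x⌉₊ : ℝ)) (theta x)
    simpa [Real.dist_eq] using this
  have h4 : Real.sin (theta x) = s := by
    rw [hth, Real.sin_add_nat_mul_two_pi, Real.sin_arcsin hs.1 hs.2]
  rw [h4] at h3
  refine (h3.trans h2).trans_lt ?_
  have h5 : (⌈x⌉₊ : ℝ) - x ≤ 1 := by linarith [Nat.ceil_lt_add_one hx0]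
  have hl : 0 ≤ Real.log (1 + x) := Real.log_nonneg (by linarith)
  have h6 : 0 ≤ (⌈x⌉₊ : ℝ) - x := by linarith [Nat.le_ceil x]
  calc _ ≤ ((⌈x⌉₊ : ℝ) - x) / (1 + x) := div_le_self (by positivity) (by linarith)
    _ ≤ 1 / (1 + x) := by gcongr
    _ < ε := by
      rw [div_lt_iff₀ (by linarith)]
      rw [div_le_iff₀ hε] at hxe
      nlinarith


lemma aux_H : ∃ H h : ℝ → ℝ, (∀ s ∈ Icc (-1:ℝ) 1, |h s| ≤ 2) ∧
    (∀ s t, |h s - h t| ≤ 2 * |s - t|) ∧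
    (∀ s, ∀ r ∈ Icc (-2:ℝ) 2, s * r - h s ≤ H r) ∧
    (∀ r ∈ Icc (-2:ℝ) 2, ∃ s ∈ Icc (-1:ℝ) 1, s * r - h s = H r) ∧
    (∀ u v : ℝ, -2 ≤ u → u < v → v ≤ 2 → ∃ x ∈ Ioo u v, ¬ DifferentiableAt ℝ H x) := by
  have : Nonempty (Icc (-2:ℝ) 2) := ⟨⟨0, by norm_num, by norm_num⟩⟩
  set X : ℕ → ℝ := fun k => (TopologicalSpace.denseSeq (Icc (-2:ℝ) 2) k : ℝ) with hX
  have hXm : ∀ k, X k ∈ Icc (-2:ℝ) 2 := fun k => (TopologicalSpace.denseSeq (Icc (-2:ℝ) 2) k).2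
  set c : ℕ → ℝ := fun k => 1 / 2 / 2 ^ k with hc
  have hcpos : ∀ k, 0 < c k := fun k => by simp only [hc]; positivity
  have hcs : HasSum c 1 := hasSum_geometric_two' 1
  have hsumM : ∀ (f : ℕ → ℝ) (M : ℝ), (∀ k, |f k| ≤ M) → Summable (fun k => c k * f k) ∧
      |∑' k, c k * f k| ≤ M := by
    intro f M hf
    have hb : ∀ k, ‖c k * f k‖ ≤ c k * M := by
      intro k
      rw [norm_mul, Real.norm_eq_abs, Real.norm_eq_abs, abs_of_pos (hcpos k)]
      exact mul_le_mul_of_nonneg_left (hf k) (hcpos k).le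
    have hs : HasSum (fun k => c k * M) M := by simpa using hcs.mul_right M
    exact ⟨Summable.of_norm_bounded hs.summable hb, tsum_of_norm_bounded hs hb⟩
  have hXa : ∀ k, |X k| ≤ 2 := fun k => abs_le.2 (hXm k)
  have hS : ∀ r, Summable (fun k => c k * |r - X k|) := by
    intro r
    refine (hsumM _ (|r| + 2) fun k => ?_).1
    rw [abs_abs]
    exact (abs_sub _ _).trans (by linarith [hXa k])
  set H : ℝ → ℝ := fun r => ∑' k, c k * |r - X k| with hH
  have hH0 : ∀ r, 0 ≤ H r := fun r => tsum_nonneg fun k => mul_nonneg (hcpos k).le (abs_nonneg _)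
  have hHz : H 0 ≤ 2 := by
    refine (le_abs_self _).trans (hsumM _ 2 fun k => ?_).2
    simpa using hXa k
  set h : ℝ → ℝ := fun s => sSup ((fun r => s * r - H r) '' Icc (-2:ℝ) 2) with hh
  have hne : ∀ s, ((fun r => s * r - H r) '' Icc (-2:ℝ) 2).Nonempty :=
    fun s => ⟨_, 0, ⟨by norm_num, by norm_num⟩, rfl⟩
  have hub : ∀ s, ∀ r ∈ Icc (-2:ℝ) 2, s * r - H r ≤ 2 * |s| := by
    intro s r hr
    have h1 : |s * r| ≤ |s| * 2 := by
      rw [abs_mul]; exact mul_le_mul_of_nonneg_left (abs_le.2 hr) (abs_nonneg _)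
    linarith [le_abs_self (s * r), hH0 r]
  have hbdd : ∀ s, BddAbove ((fun r => s * r - H r) '' Icc (-2:ℝ) 2) := by
    rintro s
    refine ⟨2 * |s|, ?_⟩
    rintro _ ⟨r, hr, rfl⟩
    exact hub s r hr
  have hle : ∀ s, ∀ r ∈ Icc (-2:ℝ) 2, s * r - H r ≤ h s :=
    fun s r hr => le_csSup (hbdd s) ⟨r, hr, rfl⟩
  have hlip : ∀ s t, h s - h t ≤ 2 * |s - t| := by
    intro s t
    suffices h s ≤ h t + 2 * |s - t| by linarith
    apply csSup_le (hne s)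
    rintro _ ⟨r, hr, rfl⟩
    have h1 : |(s - t) * r| ≤ |s - t| * 2 := by
      rw [abs_mul]; exact mul_le_mul_of_nonneg_left (abs_le.2 hr) (abs_nonneg _)
    have := hle t r hr
    have h2 := le_abs_self ((s-t)*r)
    simp only
    nlinarith
  refine ⟨H, h, ?_, ?_, ?_, ?_, ?_⟩
  · intro s hs
    rw [abs_le]
    constructor
    · have := hle s 0 ⟨by norm_num, by norm_num⟩
      linarith
    · apply csSup_le (hne s)
      rintro _ ⟨r, hr, rfl⟩
      have := hub s r hr
      have h2 : |s| ≤ 1 := abs_le.2 hs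
      simp only
      linarith
  · intro s t
    rw [abs_le]
    constructor
    · have := hlip t s
      rw [abs_sub_comm] at this; linarith
    · exact hlip s t
  · intro s r hr
    linarith [hle s r hr]
  · intro r hr
    have hsg : ∀ x : ℝ, |Real.sign x| ≤ 1 := by
      intro x
      rcases Real.sign_apply_eq x with h | h | h <;> simp [h]
    obtain ⟨hgs, hgb⟩ := hsumM (fun k => Real.sign (r - X k)) 1 (fun k => hsg _)
    set g := ∑' k, c k * Real.sign (r - X k) with hg
    refine ⟨g, abs_le.1 hgb, ?_⟩
    have h1 : h g ≤ g * r - H r := by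
      apply csSup_le (hne g)
      rintro _ ⟨t, ht, rfl⟩
      have : H r + g * (t - r) ≤ H t := by
        have e1 := (hS r).hasSum.add (hgs.hasSum.mul_right (t - r))
        refine hasSum_le (fun k => ?_) e1 (hS t).hasSum
        have : |r - X k| + Real.sign (r - X k) * (t - r) ≤ |t - X k| := by
          rcases lt_trichotomy (r - X k) 0 with h | h | h
          · rw [Real.sign_of_neg h, abs_of_neg h]; linarith [neg_abs_le (t - X k)]
          · rw [h]; simp
          · rw [Real.sign_of_pos h, abs_of_pos h]; linarith [le_abs_self (t - X k)]
        nlinarith [hcpos k]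
      simp only
      nlinarith
    linarith [hle g r hr]
  · intro u v hu huv hv
    have hd := TopologicalSpace.denseRange_denseSeq (Icc (-2:ℝ) 2)
    obtain ⟨k, hk⟩ := hd.exists_mem_open (s := (Subtype.val ⁻¹' (Ioo u v) : Set (Icc (-2:ℝ) 2)))
      (isOpen_Ioo.preimage continuous_subtype_val)
      ⟨⟨(u+v)/2, by constructor <;> linarith⟩, by constructor <;> simp only <;> linarith⟩
    refine ⟨X k, hk, fun hdiff => ?_⟩
    have key : ∀ δ : ℝ, c k * (2 * |δ|) ≤ H (X k + δ) + H (X k - δ) - 2 * H (X k) := by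
      intro δ
      have e := ((hS (X k + δ)).hasSum.add (hS (X k - δ)).hasSum).sub ((hS (X k)).hasSum.mul_left 2)
      have := le_hasSum e k (fun j _ => ?_)
      · refine le_trans (le_of_eq ?_) this
        simp
        ring
      · have : 2 * |X k - X j| ≤ |X k + δ - X j| + |X k - δ - X j| := by
          calc 2 * |X k - X j| = |(X k + δ - X j) + (X k - δ - X j)| := by
                rw [show (X k + δ - X j) + (X k - δ - X j) = 2 * (X k - X j) by ring, abs_mul]; simp
            _ ≤ _ := abs_add_le _ _
        nlinarith [hcpos j]
    have hd1 : HasDerivAt H (deriv H (X k)) (X k + 0) := by simpa using hdiff.hasDerivAt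
    have hd2 : HasDerivAt H (deriv H (X k)) (X k - 0) := by simpa using hdiff.hasDerivAt
    have hd3 : HasDerivAt (fun δ => H (X k + δ) + H (X k - δ) - 2 * H (X k)) 0 0 := by
      have a1 := hd1.comp (0:ℝ) ((hasDerivAt_id (0:ℝ)).const_add (X k))
      have a2 := hd2.comp (0:ℝ) ((hasDerivAt_id (0:ℝ)).const_sub (X k))
      have := (a1.add a2).sub_const (2 * H (X k))
      have e0 : deriv H (X k) * 1 + deriv H (X k) * (-1) = 0 := by ring
      rw [e0] at this
      exact this
    have := hd3.isLittleO.def (hcpos k)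
    obtain ⟨δ, h1, h2⟩ := ((this.filter_mono nhdsWithin_le_nhds).and (self_mem_nhdsWithin (s := Ioi (0:ℝ)))).exists
    have h2' : 0 < δ := h2
    have h3 := key δ
    simp only [add_zero, sub_zero, smul_zero, Real.norm_eq_abs] at h1
    have h4 := (le_abs_self _).trans h1
    rw [abs_of_pos h2'] at h3 h4
    have := mul_pos (hcpos k) h2'
    linarith

/-- normalized L -/
def LL (q : ℝ) : ℝ := Real.log (1 + 2 ^ q) / Real.log 2 - q * (Real.log 3 / Real.log 2)

lemma LL_one : LL 1 = 0 := by
  simp [LL]; norm_num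

lemma LL_deriv (q : ℝ) : HasStrictDerivAt LL ((2:ℝ) ^ q / (1 + 2 ^ q) - Real.log 3 / Real.log 2) q := by
  have h2 : (0:ℝ) < 2 ^ q := Real.rpow_pos_of_pos (by norm_num) _
  have hl : 0 < Real.log 2 := Real.log_pos (by norm_num)
  have a1 : HasStrictDerivAt (fun q : ℝ => (2:ℝ) ^ q) (2 ^ q * Real.log 2) q :=
    Real.hasStrictDerivAt_const_rpow (by norm_num) q
  have a2 := ((a1.const_add 1).log (by positivity)).div_const (Real.log 2)
  have a3 := (hasStrictDerivAt_id q).mul_const (Real.log 3 / Real.log 2)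
  have e0 : (2:ℝ) ^ q / (1 + 2 ^ q) - Real.log 3 / Real.log 2 =
    2 ^ q * Real.log 2 / (1 + 2 ^ q) / Real.log 2 - 1 * (Real.log 3 / Real.log 2) := by
    field_simp
  rw [e0]
  exact a2.sub a3

lemma LL_mvt (q : ℝ) (hq : 1 < q) : ∃ ξ ∈ Ioo 1 q,
    LL q / (q - 1) = (2:ℝ) ^ ξ / (1 + 2 ^ ξ) - Real.log 3 / Real.log 2 := by
  obtain ⟨ξ, h1, h2⟩ := exists_hasDerivAt_eq_slope LL
    (fun q => (2:ℝ) ^ q / (1 + 2 ^ q) - Real.log 3 / Real.log 2) hq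
    (fun x _ => (LL_deriv x).hasDerivAt.continuousAt.continuousWithinAt)
    (fun x _ => (LL_deriv x).hasDerivAt)
  refine ⟨ξ, h1, ?_⟩
  rw [h2, LL_one, sub_zero]

lemma log32 : 0 < Real.log 3 / Real.log 2 ∧ Real.log 3 / Real.log 2 < 2 := by
  have hl : 0 < Real.log 2 := Real.log_pos (by norm_num)
  refine ⟨div_pos (Real.log_pos (by norm_num)) hl, ?_⟩
  rw [div_lt_iff₀ hl, show (2:ℝ) * Real.log 2 = Real.log (2^2) by rw [Real.log_pow]; norm_num]
  exact Real.log_lt_log (by norm_num) (by norm_num)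

def rr (q : ℝ) : ℝ := LL q / (q - 1)

lemma rr_mem (q : ℝ) (hq : 1 < q) : rr q ∈ Icc (-2:ℝ) 2 := by
  obtain ⟨ξ, _, h⟩ := LL_mvt q hq
  have h2 : (0:ℝ) < 2 ^ ξ := Real.rpow_pos_of_pos (by norm_num) _
  have h3 : (2:ℝ) ^ ξ / (1 + 2 ^ ξ) ≤ 1 := by rw [div_le_one (by positivity)]; linarith
  have h4 : 0 < (2:ℝ) ^ ξ / (1 + 2 ^ ξ) := by positivity
  have := log32
  rw [rr, h]
  constructor <;> linarith

lemma rr_deriv (q : ℝ) (hq : 1 < q) : ∃ d : ℝ, 0 < d ∧ HasStrictDerivAt rr d q := by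
  have hq' : 0 < q - 1 := by linarith
  have a := (LL_deriv q).div ((hasStrictDerivAt_id q).sub_const 1) (by simpa using hq'.ne')
  refine ⟨_, ?_, a⟩
  obtain ⟨ξ, hξ, h⟩ := LL_mvt q hq
  rw [div_eq_iff hq'.ne'] at h
  have h5 : (2:ℝ) ^ ξ < 2 ^ q := Real.rpow_lt_rpow_of_exponent_lt (by norm_num) hξ.2
  have h2 : (0:ℝ) < 2 ^ ξ := Real.rpow_pos_of_pos (by norm_num) _
  have h2' : (0:ℝ) < 2 ^ q := Real.rpow_pos_of_pos (by norm_num) _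
  have h6 : (2:ℝ) ^ ξ / (1 + 2 ^ ξ) < 2 ^ q / (1 + 2 ^ q) := by
    rw [div_lt_div_iff₀ (by positivity) (by positivity)]; nlinarith
  apply div_pos _ (by simp only [id]; positivity)
  simp only [id, mul_one]
  rw [h]
  nlinarith

lemma nondiff_transfer (H : ℝ → ℝ) (q : ℝ) (hq : 1 < q) (hH : ¬ DifferentiableAt ℝ H (rr q))
    (T : ℝ → ℝ)
    (hT : ∀ q, 1 < q → T q = (q - 1) / 2 * (rr q / 2 - 1 / 2 + H (rr q) / 4)) :
    ¬ DifferentiableAt ℝ T q := by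
  intro hd
  apply hH
  obtain ⟨d, hd0, hr⟩ := rr_deriv q hq
  have hrd : DifferentiableAt ℝ rr q := hr.hasDerivAt.differentiableAt
  have h1 : DifferentiableAt ℝ (fun q => H (rr q)) q := by
    have : DifferentiableAt ℝ (fun q => 4 * (T q * 2 / (q - 1) - rr q / 2 + 1 / 2)) q := by
      have : q - 1 ≠ 0 := by linarith
      fun_prop (disch := assumption)
    refine this.congr_of_eventuallyEq ?_
    filter_upwards [lt_mem_nhds hq] with y hy
    rw [hT y hy]
    have : y - 1 ≠ 0 := by linarith
    field_simp
    ring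
  have h2 := hr.to_localInverse hd0.ne'
  set g := hr.localInverse rr d q hd0.ne'
  have hgq : g (rr q) = q := HasStrictFDerivAt.localInverse_apply_image _
  have hev : ∀ᶠ y in nhds (rr q), rr (g y) = y := HasStrictFDerivAt.eventually_right_inverse _
  have h3 : DifferentiableAt ℝ ((fun q => H (rr q)) ∘ g) (rr q) := by
    apply DifferentiableAt.comp
    · rw [hgq]; exact h1
    · exact h2.hasDerivAt.differentiableAt
  refine h3.congr_of_eventuallyEq ?_
  filter_upwards [hev] with y hy
  simp [hy]

lemma dense_transfer (H : ℝ → ℝ)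
    (hH : ∀ u v : ℝ, -2 ≤ u → u < v → v ≤ 2 → ∃ x ∈ Ioo u v, ¬ DifferentiableAt ℝ H x) :
    Ioi (1:ℝ) ⊆ closure {q | 1 < q ∧ ¬ DifferentiableAt ℝ H (rr q)} := by
  intro q hq
  rw [Metric.mem_closure_iff]
  intro ε hε
  have hq : 1 < q := hq
  have hcont : ContinuousOn rr (Icc q (q + ε/2)) := by
    intro x hx
    obtain ⟨d, _, h⟩ := rr_deriv x (by linarith [hx.1])
    exact h.hasDerivAt.continuousAt.continuousWithinAt
  have hmono : StrictMonoOn rr (Icc q (q + ε/2)) := by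
    apply strictMonoOn_of_deriv_pos (convex_Icc _ _) hcont
    intro x hx
    rw [interior_Icc] at hx
    obtain ⟨d, h0, h⟩ := rr_deriv x (by linarith [hx.1])
    rw [h.hasDerivAt.deriv]; exact h0
  have hlt := hmono (left_mem_Icc.2 (by linarith)) (right_mem_Icc.2 (by linarith)) (show q < q + ε/2 by linarith)
  obtain ⟨x, hx, hxd⟩ := hH _ _ (rr_mem q hq).1 hlt (rr_mem _ (by linarith)).2
  obtain ⟨y, hy, rfl⟩ := intermediate_value_Icc (by linarith) hcont (Ioo_subset_Icc_self hx)
  refine ⟨y, ⟨by linarith [hy.1], hxd⟩, ?_⟩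
  rw [Real.dist_eq, abs_lt]
  constructor <;> linarith [hy.1, hy.2]

lemma exists_bern (p : ℕ → ℝ) (hp : ∀ n, p n ∈ Ioo (0:ℝ) 1) :
    ∃ μ : Measure (ℕ → Bool), IsBernoulliProduct p μ := by
  let ν : ℕ → Measure Bool := fun n =>
    ENNReal.ofReal (p n) • Measure.dirac false + ENNReal.ofReal (1 - p n) • Measure.dirac true
  have hν : ∀ n, IsProbabilityMeasure (ν n) := by
    intro n
    constructor
    simp only [ν, Measure.add_apply, Measure.smul_apply, measure_univ, smul_eq_mul, mul_one]
    rw [← ENNReal.ofReal_add (hp n).1.le (by linarith [(hp n).2])]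
    simp
  refine ⟨Measure.infinitePi ν, inferInstance, ?_⟩
  intro n ε
  have hc : cyl ε = Set.pi (Finset.range n : Set ℕ)
      (fun i => if h : i < n then {ε ⟨i, h⟩} else univ) := by
    ext x
    simp only [cyl, mem_setOf_eq, Set.mem_pi, Finset.coe_range, mem_Iio]
    constructor
    · intro h i hi
      simp [hi, h ⟨i, hi⟩]
    · intro h i
      have := h i i.2
      simpa using this
  rw [hc, Measure.infinitePi_pi ν (fun i _ => MeasurableSet.of_discrete)]
  rw [ENNReal.ofReal_prod_of_nonneg, Finset.prod_range]
  · apply Finset.prod_congr rfl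
    intro i _
    simp only [Fin.is_lt, dif_pos, ν]
    cases h : ε i <;> simp [h]
  · intro i _
    split_ifs
    · linarith [(hp i).2]
    · exact (hp i).1.le

lemma tauN_eq (p : ℕ → ℝ) (hp : ∀ n, p n ∈ Ioo (0:ℝ) 1) (μ : Measure (ℕ → Bool))
    (hμ : IsBernoulliProduct p μ) (n : ℕ) (q : ℝ) :
    tauN μ n q = (n:ℝ)⁻¹ * ∑ j ∈ Finset.range n, Real.log (p j ^ q + (1 - p j) ^ q) / Real.log 2 := by
  have hnn : ∀ (ε : Fin n → Bool) (i : Fin n), 0 ≤ (if ε i then 1 - p (i : ℕ) else p (i : ℕ)) := by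
    intro ε i
    split_ifs
    · linarith [(hp i).2]
    · exact (hp i).1.le
  have h1 : ∑ ε : Fin n → Bool, (μ (cyl ε)).toReal ^ q =
      ∏ j ∈ Finset.range n, (p j ^ q + (1 - p j) ^ q) := by
    rw [Finset.prod_range]
    have := Finset.prod_univ_sum (fun _ : Fin n => (Finset.univ : Finset Bool))
      (fun i b => (if b then 1 - p (i : ℕ) else p (i : ℕ)) ^ q)
    simp only [Fintype.piFinset_univ, Fintype.sum_bool, if_true, Bool.false_eq_true, if_false] at this
    rw [show (∏ i : Fin n, (p i ^ q + (1 - p i) ^ q)) = ∏ i : Fin n, ((1 - p i) ^ q + p i ^ q) from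
      Finset.prod_congr rfl (fun i _ => add_comm _ _), this]
    apply Finset.sum_congr rfl
    intro ε _
    rw [hμ.2, ENNReal.toReal_ofReal (Finset.prod_nonneg fun i _ => hnn ε i),
      Real.finsetProd_rpow _ _ (fun i _ => hnn ε i)]
  rw [tauN, h1, Real.log_prod, ← Finset.sum_div]
  · rw [one_div, mul_inv]; ring
  · intro j _
    have := Real.rpow_pos_of_pos (hp j).1 q
    have := Real.rpow_pos_of_pos (show 0 < 1 - p j by linarith [(hp j).2]) q
    positivity

lemma wsum (n : ℕ) : (∑ j ∈ Finset.range n, (if Even j then (1:ℝ) else 0)) =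
    (n + (if Even n then 0 else 1)) / 2 := by
  induction n with
  | zero => simp
  | succ n ih =>
    rw [Finset.sum_range_succ, ih]
    by_cases h : Even n
    · simp [h, Nat.even_add_one]; ring
    · simp [h, Nat.even_add_one]

lemma wsum' (n : ℕ) : (∑ j ∈ Finset.range n, (if Even j then (0:ℝ) else 1)) =
    (n - (if Even n then 0 else 1)) / 2 := by
  induction n with
  | zero => simp
  | succ n ih =>
    rw [Finset.sum_range_succ, ih]
    by_cases h : Even n
    · simp [h, Nat.even_add_one]
    · simp [h, Nat.even_add_one]; ring

lemma val_half (q : ℝ) : Real.log ((1/2:ℝ) ^ q + (1 - 1/2) ^ q) / Real.log 2 = 1 - q := by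
  have hl : 0 < Real.log 2 := Real.log_pos (by norm_num)
  have : (0:ℝ) < (1/2) ^ q := Real.rpow_pos_of_pos (by norm_num) _
  rw [show (1 - 1/2 : ℝ) = 1/2 by norm_num, ← two_mul, Real.log_mul (by norm_num) this.ne',
    Real.log_rpow (by norm_num), one_div, Real.log_inv]
  field_simp
  ring

lemma z_tendsto (q : ℝ) (hq : 1 < q) : Tendsto (fun j : ℕ =>
    Real.log ((1 / ((j:ℝ) + 2)) ^ q + (1 - 1 / ((j:ℝ) + 2)) ^ q) / Real.log 2) atTop (nhds 0) := by
  have h1 : Tendsto (fun j : ℕ => 1 / ((j:ℝ) + 2)) atTop (nhds 0) := by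
    have := tendsto_const_div_atTop_nhds_zero_nat (1:ℝ)
    have := (tendsto_add_atTop_iff_nat 2).2 this
    refine this.congr fun n => by push_cast; rfl
  have h2 := h1.rpow_const (p := q) (Or.inr (by linarith))
  have h3 := (h1.const_sub 1).rpow_const (p := q) (Or.inr (by linarith))
  have h4 := h2.add h3
  rw [Real.zero_rpow (by linarith)] at h4
  simp only [sub_zero, Real.one_rpow, zero_add] at h4
  have h5 := (h4.log one_ne_zero).div_const (Real.log 2)
  simpa using h5

lemma limsup_val (u v : ℕ → ℝ) (M : ℝ) (huv : Tendsto (fun n => u n - v n) atTop (nhds 0))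
    (hv : ∀ n, v n ≤ M) (hf : ∀ ε > 0, ∃ᶠ n in atTop, M - ε < v n) :
    limsup u atTop = M := by
  have hup : ∀ ε > 0, ∀ᶠ n in atTop, u n ≤ M + ε := by
    intro ε hε
    filter_upwards [huv.eventually (gt_mem_nhds hε)] with n hn
    linarith [hv n]
  have hlo : ∀ ε > 0, ∃ᶠ n in atTop, M - ε ≤ u n := by
    intro ε hε
    have := (hf (ε/2) (by linarith)).and_eventually
      (huv.eventually (lt_mem_nhds (show -(ε/2) < 0 by linarith)))
    refine this.mono fun n hn => by linarith [hn.1, hn.2]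
  have hbd : IsBoundedUnder (· ≤ ·) atTop u := ⟨M + 1, by simpa using hup 1 one_pos⟩
  have hcb : IsCoboundedUnder (· ≤ ·) atTop u := IsCoboundedUnder.of_frequently_ge (hlo 1 one_pos)
  apply le_antisymm
  · apply le_of_forall_pos_le_add
    intro ε hε
    exact limsup_le_of_le hcb (hup ε hε)
  · apply le_of_forall_pos_le_add
    intro ε hε
    have := le_limsup_of_frequently_le (hlo ε hε) hbd
    linarith

lemma val_third (q : ℝ) : Real.log ((1/3:ℝ) ^ q + (1 - 1/3) ^ q) / Real.log 2 = LL q := by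
  have h2 : (0:ℝ) < 2 ^ q := Real.rpow_pos_of_pos (by norm_num) _
  have h3 : (0:ℝ) < 3 ^ q := Real.rpow_pos_of_pos (by norm_num) _
  rw [show (1 - 1/3 : ℝ) = 2/3 by norm_num, Real.div_rpow (by norm_num) (by norm_num),
    Real.div_rpow (by norm_num) (by norm_num), Real.one_rpow, ← add_div,
    Real.log_div (by positivity) (by positivity), Real.log_rpow (by norm_num), LL]
  ring

/-- Theorem 1.3: dense phase transitions. There is a sequence of
weights `(pₙ) ⊂ (0,1)` whose inhomogeneous Bernoulli product `μ` has an `L^q`-spectrum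
`τ_μ` failing to be differentiable at every point of a subset of `(1,∞)` which is dense
in `(1,∞)`. -/
theorem statement3 :
    ∃ p : ℕ → ℝ, (∀ n, p n ∈ Set.Ioo (0 : ℝ) 1) ∧
      ∃ μ : Measure (ℕ → Bool), IsBernoulliProduct p μ ∧
        ∃ D : Set ℝ, D ⊆ Set.Ioi (1 : ℝ) ∧ Set.Ioi (1 : ℝ) ⊆ closure D ∧
          ∀ q ∈ D, ¬ DifferentiableAt ℝ (tauLq μ) q := by
  obtain ⟨H, h, hb, hlip, hle, hex, hnd⟩ := aux_H
  set s : ℕ → ℝ := fun n => Real.sin (theta n) with hs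
  have hsm : ∀ n, s n ∈ Icc (-1:ℝ) 1 := fun n => ⟨Real.neg_one_le_sin _, Real.sin_le_one _⟩
  have hslow : Tendsto (fun n : ℕ => ((n : ℝ) + 1) * |s (n+1) - s n|) atTop (nhds 0) := sin_slow
  set α : ℕ → ℝ := fun n => 1 / 2 + h (s n) / 4 with hα
  set β : ℕ → ℝ := fun n => 1 / 2 + s n / 4 with hβ
  have hα01 : ∀ j, 0 ≤ α j ∧ α j ≤ 1 := by
    intro j
    have := abs_le.1 (hb _ (hsm j))
    simp only [hα]
    constructor <;> linarith [this.1, this.2]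
  have hβ01 : ∀ j, 0 ≤ β j ∧ β j ≤ 1 := by
    intro j
    have := hsm j
    simp only [hβ]
    constructor <;> linarith [this.1, this.2]
  have hαs : Tendsto (fun n : ℕ => ((n : ℝ) + 1) * |α (n+1) - α n|) atTop (nhds 0) := by
    refine squeeze_zero (fun n => by positivity) (fun n => ?_) hslow
    refine mul_le_mul_of_nonneg_left ?_ (by positivity)
    have h1 := hlip (s (n+1)) (s n)
    have h2 : α (n+1) - α n = (h (s (n+1)) - h (s n)) / 4 := by simp only [hα]; ring
    rw [h2, abs_div, abs_of_pos (show (0:ℝ) < 4 by norm_num)]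
    linarith [abs_nonneg (s (n+1) - s n)]
  have hβs : Tendsto (fun n : ℕ => ((n : ℝ) + 1) * |β (n+1) - β n|) atTop (nhds 0) := by
    refine squeeze_zero (fun n => by positivity) (fun n => ?_) hslow
    refine mul_le_mul_of_nonneg_left ?_ (by positivity)
    have h2 : β (n+1) - β n = (s (n+1) - s n) / 4 := by simp only [hβ]; ring
    rw [h2, abs_div, abs_of_pos (show (0:ℝ) < 4 by norm_num)]
    linarith [abs_nonneg (s (n+1) - s n)]
  obtain ⟨A, hA1, hA2, hA3⟩ := aux_comb α (fun j => if Even j then (1:ℝ) else 0) hα01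
    (fun j => by by_cases h : Even j <;> simp [h]) hαs
    (fun n => by rw [wsum]; split_ifs <;> rw [abs_le] <;> constructor <;> linarith)
  obtain ⟨B, hB1, hB2, hB3⟩ := aux_comb β (fun j => if Even j then (0:ℝ) else 1) hβ01
    (fun j => by by_cases h : Even j <;> simp [h]) hβs
    (fun n => by rw [wsum']; split_ifs <;> rw [abs_le] <;> constructor <;> linarith)
  have hAB : ∀ j, A j = 0 ∨ B j = 0 := by
    intro j
    by_cases h : Even j
    · right; exact hB2 j (by simp [h])
    · left; exact hA2 j (by simp [h])
  set p : ℕ → ℝ := fun j => if A j = 1 then 1/2 else if B j = 1 then 1/3 else 1 / ((j:ℝ) + 2) with hp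
  have hp01 : ∀ n, p n ∈ Ioo (0:ℝ) 1 := by
    intro n
    simp only [hp]
    split_ifs
    · norm_num
    · norm_num
    · have : (0:ℝ) ≤ n := by positivity
      constructor
      · positivity
      · rw [div_lt_one (by positivity)]; linarith
  obtain ⟨μ, hμ⟩ := exists_bern p hp01
  have hT : ∀ q, 1 < q → tauLq μ q = (q - 1) / 2 * (rr q / 2 - 1 / 2 + H (rr q) / 4) := by
    intro q hq
    have hq1 : 0 < q - 1 := by linarith
    have hr := rr_mem q hq
    have hLL : LL q = (q - 1) * rr q := by rw [rr]; field_simp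
    set z : ℕ → ℝ := fun j =>
      Real.log ((1 / ((j:ℝ) + 2)) ^ q + (1 - 1 / ((j:ℝ) + 2)) ^ q) / Real.log 2 with hz
    have hz0 : Tendsto z atTop (nhds 0) := z_tendsto q hq
    have hz1 : Tendsto (fun j => (1 - A j - B j) * z j) atTop (nhds 0) := by
      refine squeeze_zero_norm (fun j => ?_) (tendsto_norm_zero.comp hz0)
      rw [norm_mul]
      refine mul_le_of_le_one_left (norm_nonneg _) ?_
      rcases hA1 j with h1 | h1 <;> rcases hB1 j with h2 | h2 <;> rw [h1, h2] <;> norm_num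
    have hterm : ∀ j, Real.log (p j ^ q + (1 - p j) ^ q) / Real.log 2 =
        A j * (1 - q) + B j * LL q + (1 - A j - B j) * z j := by
      intro j
      rcases hA1 j with h1 | h1
      · rcases hB1 j with h2 | h2
        · simp [hp, hz, h1, h2]
        · simp only [hp, h1, h2, zero_ne_one, if_false, if_true]
          rw [val_third]; ring
      · have h2 : B j = 0 := by
          rcases hAB j with h | h
          · rw [h1] at h; norm_num at h
          · exact h
        simp only [hp, h1, h2, if_true]
        rw [val_half]; ring
    refine limsup_val _ (fun n => (q - 1) / 2 * (β n * rr q - α n)) _ ?_ ?_ ?_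
    · have e := ((hA3.mul_const (1 - q)).add (hB3.mul_const (LL q))).add hz1.cesaro
      simp only [zero_mul, add_zero] at e
      refine e.congr fun n => ?_
      rw [tauN_eq p hp01 μ hμ]
      simp_rw [hterm]
      rw [Finset.sum_add_distrib, Finset.sum_add_distrib, ← Finset.sum_mul, ← Finset.sum_mul, hLL]
      ring
    · intro n
      refine mul_le_mul_of_nonneg_left ?_ (by linarith)
      have := hle (s n) (rr q) hr
      simp only [hα, hβ]
      linarith
    · intro ε hε
      obtain ⟨t, ht, hte⟩ := hex (rr q) hr
      refine (sin_freq t ht (ε / (q - 1)) (by positivity)).mono fun n hn => ?_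
      have hn : |s n - t| < ε / (q - 1) := hn
      rw [lt_div_iff₀ hq1] at hn
      have h1 := (le_abs_self _).trans (hlip (s n) t)
      have h2 : |(s n - t) * rr q| ≤ |s n - t| * 2 := by
        rw [abs_mul]; exact mul_le_mul_of_nonneg_left (abs_le.2 hr) (abs_nonneg _)
      have h3 := neg_abs_le ((s n - t) * rr q)
      have h4 : H (rr q) - 4 * |s n - t| ≤ s n * rr q - h (s n) := by
        rw [← hte]; linarith
      have h5 : rr q / 2 - 1 / 2 + H (rr q) / 4 - |s n - t| ≤ β n * rr q - α n := by
        simp only [hα, hβ]; linarith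
      have h6 := mul_le_mul_of_nonneg_left h5 (show 0 ≤ (q-1)/2 by linarith)
      linarith
  refine ⟨p, hp01, μ, hμ, {q | 1 < q ∧ ¬ DifferentiableAt ℝ H (rr q)}, fun q hq => hq.1,
    dense_transfer H hnd, ?_⟩
  intro q hq
  exact nondiff_transfer H q hq.1 hq.2 _ hT
end
end

section
/- Let τ = λ τ(p_1,·) + (1-λ) τ(p_2,·) with 0 < p_1 < p_2 < 1/2 and λ ∈ (0,1), and let p_0 ∈ (0,1/2). Then exactly one of the following holds: (1) τ(q) ≠ τ(p_0,q) for all q > 1; or (2) there exists q_0 > 1 such that τ(q) > τ(p_0,q) for all q ∈ (1,q_0) and τ(q) < τ(p_0,q) for all q > q_0; in case (2), q_0 is the unique point of (1,∞) at which τ and τ(p_0,·) coincide. -/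
open MeasureTheory Filter Set

noncomputable section

/-- `τ(p,q) = log(p^q + (1-p)^q) / log 2`, the `L^q`-spectrum of the homogeneous
Bernoulli product with weight `p`. -/
def taup (p q : ℝ) : ℝ :=
  Real.log (p ^ q + (1 - p) ^ q) / Real.log 2

lemma aux_tanh (u : ℝ) (hu : 0 < u) :
    2 * (Real.exp u - 1) ≤ u * (Real.exp u + 1) := by
  have hd : ∀ x : ℝ, HasDerivAt (fun u : ℝ => u * (Real.exp u + 1) - 2 * (Real.exp u - 1))
      (1 + (x - 1) * Real.exp x) x := by
    intro x
    have h1 := (hasDerivAt_id x).mul ((Real.hasDerivAt_exp x).add_const 1)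
    have h2 := ((Real.hasDerivAt_exp x).sub_const 1).const_mul 2
    refine (h1.sub h2).congr_deriv ?_
    simp only [id]
    ring
  have hm : Monotone (fun u : ℝ => u * (Real.exp u + 1) - 2 * (Real.exp u - 1)) := by
    apply monotone_of_deriv_nonneg
    · exact fun x => (hd x).differentiableAt
    · intro x
      rw [(hd x).deriv]
      have h1 := Real.add_one_le_exp (-x)
      have h2 : Real.exp (-x) * Real.exp x = 1 := by
        rw [← Real.exp_add]; simp
      nlinarith [Real.exp_pos x]
  have := hm hu.le
  simp at this
  linarith

def auxR (q t : ℝ) : ℝ := t / (Real.exp ((q - 1) * t) - 1) + t / (1 + Real.exp (q * t))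

lemma auxR_anti (q : ℝ) (hq : 1 < q) : StrictAntiOn (auxR q) (Ioi 0) := by
  have hd : ∀ t : ℝ, 0 < t → HasDerivAt (auxR q)
      ((1 * (Real.exp ((q - 1) * t) - 1) - t * (Real.exp ((q - 1) * t) * (q - 1))) /
          (Real.exp ((q - 1) * t) - 1) ^ 2
        + (1 * (1 + Real.exp (q * t)) - t * (Real.exp (q * t) * q)) /
          (1 + Real.exp (q * t)) ^ 2) t := by
    intro t ht
    have hU : 1 < Real.exp ((q - 1) * t) :=
      Real.one_lt_exp_iff.2 (mul_pos (by linarith) ht)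
    have h1 : HasDerivAt (fun t : ℝ => Real.exp ((q - 1) * t) - 1)
        (Real.exp ((q - 1) * t) * (q - 1)) t := by
      have := ((hasDerivAt_id t).const_mul (q - 1)).exp.sub_const 1
      simpa using this
    have h2 : HasDerivAt (fun t : ℝ => 1 + Real.exp (q * t))
        (Real.exp (q * t) * q) t := by
      have := ((hasDerivAt_id t).const_mul q).exp.const_add 1
      simpa using this
    have hX := Real.exp_pos (q * t)
    exact ((hasDerivAt_id t).div h1 (by linarith)).add ((hasDerivAt_id t).div h2 (by positivity))
  apply strictAntiOn_of_deriv_neg (convex_Ioi 0)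
  · exact fun t ht => (hd t ht).continuousAt.continuousWithinAt
  · intro t ht
    rw [interior_Ioi] at ht
    have ht : 0 < t := ht
    rw [(hd t ht).deriv]
    have hu : 0 < (q - 1) * t := mul_pos (by linarith) ht
    have hU : 1 < Real.exp ((q - 1) * t) := Real.one_lt_exp_iff.2 hu
    have hUX : Real.exp ((q - 1) * t) < Real.exp (q * t) := Real.exp_lt_exp.2 (by linarith)
    have hT := aux_tanh _ hu
    have hx : 0 < q * t := by positivity
    set U := Real.exp ((q - 1) * t)
    set X := Real.exp (q * t)
    have b1 : (1 * (U - 1) - t * (U * (q - 1))) / (U - 1) ^ 2 ≤ -(1 / (1 + U)) := by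
      rw [← neg_div, div_le_div_iff₀ (by have : 0 < U - 1 := by linarith
                                         positivity) (by linarith)]
      nlinarith
    have b2 : (1 * (1 + X) - t * (X * q)) / (1 + X) ^ 2 < 1 / (1 + X) := by
      rw [div_lt_div_iff₀ (by have : 0 < X := by linarith
                              positivity) (by linarith)]
      have : 0 < (q * t) * X * (1 + X) := by
        have : 0 < X := by linarith
        positivity
      nlinarith
    have b3 : 1 / (1 + X) < 1 / (1 + U) := by
      apply one_div_lt_one_div_of_lt <;> linarith
    linarith

def auxY (t q : ℝ) : ℝ := Real.log (1 + Real.exp (q * t)) - q * Real.log (1 + Real.exp t)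

def auxH (t q : ℝ) : ℝ :=
  t * (Real.exp (q * t) / (1 + Real.exp (q * t))) - Real.log (1 + Real.exp t)

lemma auxY_deriv (t q : ℝ) : HasDerivAt (auxY t) (auxH t q) q := by
  have h1 : HasDerivAt (fun q : ℝ => 1 + Real.exp (q * t)) (Real.exp (q * t) * t) q := by
    have := ((hasDerivAt_id q).mul_const t).exp.const_add 1
    simpa using this
  have h2 := (h1.log (by positivity)).sub ((hasDerivAt_id q).mul_const (Real.log (1 + Real.exp t)))
  refine h2.congr_deriv ?_
  unfold auxH
  ring

lemma auxF (q : ℝ) (hq : 1 < q) (t₀ t : ℝ) (ht₀ : 0 < t₀) (ht : 0 < t) (hne : t ≠ t₀) :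
    auxH t q - (1 / q + auxR q t₀) * auxY t q < auxH t₀ q - (1 / q + auxR q t₀) * auxY t₀ q := by
  set K := auxR q t₀ with hK
  have hd : ∀ t : ℝ, 0 < t → ∃ c, 0 < c ∧
      HasDerivAt (fun t => auxH t q - (1 / q + K) * auxY t q) (c * (auxR q t - K)) t := by
    intro t ht
    have hu : 0 < (q - 1) * t := mul_pos (by linarith) ht
    have hU : 1 < Real.exp ((q - 1) * t) := Real.one_lt_exp_iff.2 hu
    have hX : Real.exp (q * t) = Real.exp ((q - 1) * t) * Real.exp t := by
      rw [← Real.exp_add]; ring_nf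
    have hT := Real.exp_pos t
    have hq0 : 0 < q := by linarith
    refine ⟨q * (Real.exp (q * t) / (1 + Real.exp (q * t)) - Real.exp t / (1 + Real.exp t)), ?_, ?_⟩
    · apply mul_pos hq0
      rw [sub_pos, div_lt_div_iff₀ (by positivity) (by positivity)]
      have : Real.exp t < Real.exp (q * t) := Real.exp_lt_exp.2 (by nlinarith)
      nlinarith
    · have e1 : HasDerivAt (fun t : ℝ => Real.exp (q * t)) (Real.exp (q * t) * q) t := by
        have := ((hasDerivAt_id t).const_mul q).exp
        simpa using this
      have e2 : HasDerivAt (fun t : ℝ => 1 + Real.exp (q * t)) (Real.exp (q * t) * q) t :=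
        e1.const_add 1
      have e3 : HasDerivAt (fun t : ℝ => Real.log (1 + Real.exp t))
          (Real.exp t / (1 + Real.exp t)) t :=
        ((Real.hasDerivAt_exp t).const_add 1).log (by positivity)
      have e4 := e2.log (by positivity)
      have e5 := ((hasDerivAt_id t).mul (e1.div e2 (by positivity))).sub e3
      have e6 := (e4.sub (e3.const_mul q)).const_mul (1 / q + K)
      refine (e5.sub e6).congr_deriv ?_
      simp only [id, auxR, Pi.div_apply]
      rw [hX]
      set U := Real.exp ((q - 1) * t)
      set T := Real.exp t
      have : U - 1 ≠ 0 := by linarith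
      have : 1 + U * T ≠ 0 := by positivity
      have : 1 + T ≠ 0 := by positivity
      field_simp
      ring
  rcases lt_or_gt_of_ne hne with h | h
  · have hm : StrictMonoOn (fun t => auxH t q - (1 / q + K) * auxY t q) (Ioc 0 t₀) := by
      apply strictMonoOn_of_deriv_pos (convex_Ioc 0 t₀)
      · intro x hx
        obtain ⟨c, hc, h⟩ := hd x hx.1
        exact h.continuousAt.continuousWithinAt
      · intro x hx
        rw [interior_Ioc] at hx
        obtain ⟨c, hc, h⟩ := hd x hx.1
        rw [h.deriv]
        exact mul_pos hc (sub_pos.2 (auxR_anti q hq hx.1 ht₀ hx.2))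
    exact hm ⟨ht, h.le⟩ ⟨ht₀, le_rfl⟩ h
  · have hm : StrictAntiOn (fun t => auxH t q - (1 / q + K) * auxY t q) (Ici t₀) := by
      apply strictAntiOn_of_deriv_neg (convex_Ici t₀)
      · intro x hx
        obtain ⟨c, hc, h⟩ := hd x (lt_of_lt_of_le ht₀ hx)
        exact h.continuousAt.continuousWithinAt
      · intro x hx
        rw [interior_Ici] at hx
        have hx0 : 0 < x := lt_trans ht₀ hx
        obtain ⟨c, hc, h⟩ := hd x hx0
        rw [h.deriv]
        exact mul_neg_of_pos_of_neg hc (sub_neg.2 (auxR_anti q hq ht₀ hx0 hx))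
    exact hm (self_mem_Ici) h.le h

lemma aux_cross (q : ℝ) (hq : 1 < q) (t₀ t₁ t₂ l : ℝ) (ht₀ : 0 < t₀) (ht₁ : 0 < t₁) (ht₂ : 0 < t₂)
    (hne : t₁ ≠ t₂) (hl : 0 < l) (hl1 : l < 1)
    (h : l * auxY t₁ q + (1 - l) * auxY t₂ q - auxY t₀ q = 0) :
    l * auxH t₁ q + (1 - l) * auxH t₂ q - auxH t₀ q < 0 := by
  have hle : ∀ t, 0 < t → auxH t q - (1 / q + auxR q t₀) * auxY t q
      ≤ auxH t₀ q - (1 / q + auxR q t₀) * auxY t₀ q := by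
    intro t ht
    by_cases e : t = t₀
    · rw [e]
    · exact (auxF q hq t₀ t ht₀ ht e).le
  have a1 := hle t₁ ht₁
  have a2 := hle t₂ ht₂
  have hl' : 0 < 1 - l := by linarith
  generalize hKK : 1 / q + auxR q t₀ = K at *
  have hy : auxY t₀ q = l * auxY t₁ q + (1 - l) * auxY t₂ q := by linarith
  have key : l * (auxH t₁ q - K * auxY t₁ q) + (1 - l) * (auxH t₂ q - K * auxY t₂ q)
      < auxH t₀ q - K * auxY t₀ q := by
    by_cases e : t₁ = t₀
    · have b2 := auxF q hq t₀ t₂ ht₀ ht₂ (fun e' => hne (e.trans e'.symm))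
      rw [hKK] at b2
      have c1 := mul_le_mul_of_nonneg_left a1 hl.le
      have c2 := mul_lt_mul_of_pos_left b2 hl'
      linarith
    · have b1 := auxF q hq t₀ t₁ ht₀ ht₁ e
      rw [hKK] at b1
      have c1 := mul_lt_mul_of_pos_left b1 hl
      have c2 := mul_le_mul_of_nonneg_left a2 hl'.le
      linarith
  have : K * auxY t₀ q = K * (l * auxY t₁ q + (1 - l) * auxY t₂ q) := by rw [hy]
  linarith

lemma aux_right (D D' : ℝ → ℝ) (a b : ℝ) (hab : a < b)
    (hd : ∀ x ∈ Icc a b, HasDerivAt D (D' x) x)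
    (hz : ∀ x ∈ Icc a b, D x = 0 → D' x < 0) (ha : D a = 0) : D b < 0 := by
  have hle : ∀ ⦃x⦄, x ∈ Icc a b → D x ≤ 0 := by
    apply image_le_of_deriv_right_lt_deriv_boundary (f := D) (f' := D') (B := fun _ => 0)
      (B' := fun _ => 0)
    · exact fun x hx => (hd x hx).continuousAt.continuousWithinAt
    · exact fun x hx => (hd x ⟨hx.1, hx.2.le⟩).hasDerivWithinAt
    · exact ha.le
    · exact fun x => hasDerivAt_const x 0
    · exact fun x hx h => hz x ⟨hx.1, hx.2.le⟩ h
  have hb : b ∈ Icc a b := ⟨hab.le, le_rfl⟩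
  refine lt_of_le_of_ne (hle hb) fun h0 => ?_
  have h1 := (hd b hb).hasDerivWithinAt (s := Iio b)
  have h2 := (hasDerivWithinAt_iff_tendsto_slope' (by simp)).1 h1
  have h3 := h2.eventually (gt_mem_nhds (hz b hb h0))
  have h4 : ∀ᶠ x in nhdsWithin b (Iio b), x ∈ Ioo a b := Ioo_mem_nhdsLT hab
  obtain ⟨x, hx, hx'⟩ := (h3.and h4).exists
  have := hle ⟨hx'.1.le, hx'.2.le⟩
  rw [slope_def_field, h0, div_lt_iff_of_neg (by linarith [hx'.2])] at hx
  linarith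

lemma aux_left (D D' : ℝ → ℝ) (a b : ℝ) (hab : a < b)
    (hd : ∀ x ∈ Icc a b, HasDerivAt D (D' x) x)
    (hz : ∀ x ∈ Icc a b, D x = 0 → D' x < 0) (hb : D b = 0) : 0 < D a := by
  have := aux_right (fun x => - D (-x)) (fun x => D' (-x)) (-b) (-a) (by linarith)
    (by
      intro x hx
      have h := hd (-x) ⟨by linarith [hx.2], by linarith [hx.1]⟩
      have h2 := (h.scomp x (hasDerivAt_neg x)).neg
      refine h2.congr_deriv ?_
      simp)
    (by
      intro x hx h
      exact hz (-x) ⟨by linarith [hx.2], by linarith [hx.1]⟩ (by linarith))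
    (by simpa using hb)
  simpa using this

lemma aux_taup (p q : ℝ) (hp : 0 < p) (hp2 : p < 1 / 2) :
    taup p q = auxY (Real.log ((1 - p) / p)) q / Real.log 2 := by
  unfold taup auxY
  have h1 : 0 < 1 - p := by linarith
  congr 1
  rw [Real.exp_log (by positivity), mul_comm q, ← Real.rpow_def_of_pos (by positivity),
    Real.div_rpow h1.le hp.le]
  have hpq : 0 < p ^ q := Real.rpow_pos_of_pos hp q
  have hpq' : 0 < (1 - p) ^ q := Real.rpow_pos_of_pos h1 q
  have e1 : 1 + (1 - p) / p = 1 / p := by field_simp; ring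
  have e2 : 1 + (1 - p) ^ q / p ^ q = (p ^ q + (1 - p) ^ q) / p ^ q := by field_simp
  rw [e1, e2, Real.log_div (by positivity) (by positivity), Real.log_rpow hp, one_div, Real.log_inv]
  ring

/-- Lemma 5.1. Let `τ = λ τ(p₁,·) + (1-λ) τ(p₂,·)` with
`0 < p₁ < p₂ < 1/2` and `λ ∈ (0,1)`, and let `p₀ ∈ (0,1/2)`. Then exactly one of the
following holds: (1) `τ(q) ≠ τ(p₀,q)` for all `q > 1`; or (2) there is `q₀ > 1` with
`τ > τ(p₀,·)` on `(1,q₀)` and `τ < τ(p₀,·)` on `(q₀,∞)`, `q₀` being the unique point of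
`(1,∞)` where the two functions coincide. -/
theorem statement15
    (p₁ p₂ p₀ lam : ℝ)
    (hp₁ : 0 < p₁) (hp₁₂ : p₁ < p₂) (hp₂ : p₂ < 1 / 2)
    (hlam : lam ∈ Set.Ioo (0 : ℝ) 1) (hp₀ : p₀ ∈ Set.Ioo (0 : ℝ) (1 / 2)) :
    Xor'
      (∀ q : ℝ, 1 < q → lam * taup p₁ q + (1 - lam) * taup p₂ q ≠ taup p₀ q)
      (∃ q₀ : ℝ, 1 < q₀
        ∧ (∀ q : ℝ, 1 < q → q < q₀ →
            taup p₀ q < lam * taup p₁ q + (1 - lam) * taup p₂ q)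
        ∧ (∀ q : ℝ, q₀ < q →
            lam * taup p₁ q + (1 - lam) * taup p₂ q < taup p₀ q)
        ∧ ∀ q : ℝ, 1 < q → lam * taup p₁ q + (1 - lam) * taup p₂ q = taup p₀ q →
            q = q₀) := by
  obtain ⟨hl, hl1⟩ := hlam
  obtain ⟨hp00, hp01⟩ := hp₀
  have htpos : ∀ p : ℝ, 0 < p → p < 1 / 2 → 0 < Real.log ((1 - p) / p) := by
    intro p h h'
    apply Real.log_pos
    rw [lt_div_iff₀ h]
    linarith
  have ht0 := htpos p₀ hp00 hp01
  have ht1 := htpos p₁ hp₁ (by linarith)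
  have ht2 := htpos p₂ (by linarith) hp₂
  have hp20 : 0 < p₂ := by linarith
  have hne : Real.log ((1 - p₁) / p₁) ≠ Real.log ((1 - p₂) / p₂) := by
    apply ne_of_gt
    apply Real.log_lt_log
    · apply div_pos <;> linarith
    · rw [div_lt_div_iff₀ hp20 hp₁]
      nlinarith
  have htau : ∀ q, lam * taup p₁ q + (1 - lam) * taup p₂ q - taup p₀ q =
      (lam * auxY (Real.log ((1 - p₁) / p₁)) q + (1 - lam) * auxY (Real.log ((1 - p₂) / p₂)) q
        - auxY (Real.log ((1 - p₀) / p₀)) q) / Real.log 2 := by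
    intro q
    rw [aux_taup p₁ q hp₁ (by linarith), aux_taup p₂ q hp20 hp₂, aux_taup p₀ q hp00 hp01]
    ring
  generalize Real.log ((1 - p₁) / p₁) = t₁ at *
  generalize Real.log ((1 - p₂) / p₂) = t₂ at *
  generalize Real.log ((1 - p₀) / p₀) = t₀ at *
  have hlog2 : 0 < Real.log 2 := Real.log_pos (by norm_num)
  have hd : ∀ q, HasDerivAt (fun q => lam * auxY t₁ q + (1 - lam) * auxY t₂ q - auxY t₀ q)
      (lam * auxH t₁ q + (1 - lam) * auxH t₂ q - auxH t₀ q) q := fun q =>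
    (((auxY_deriv t₁ q).const_mul lam).add ((auxY_deriv t₂ q).const_mul (1 - lam))).sub
      (auxY_deriv t₀ q)
  have hz : ∀ q, 1 < q → lam * auxY t₁ q + (1 - lam) * auxY t₂ q - auxY t₀ q = 0 →
      lam * auxH t₁ q + (1 - lam) * auxH t₂ q - auxH t₀ q < 0 := fun q hq h =>
    aux_cross q hq t₀ t₁ t₂ lam ht0 ht1 ht2 hne hl hl1 h
  by_cases h : ∀ q : ℝ, 1 < q → lam * taup p₁ q + (1 - lam) * taup p₂ q ≠ taup p₀ q
  · refine Or.inl ⟨h, ?_⟩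
    rintro ⟨q₀, hq₀, hlt, hgt, -⟩
    have hcont : Continuous (fun q => lam * taup p₁ q + (1 - lam) * taup p₂ q - taup p₀ q) := by
      have : (fun q => lam * taup p₁ q + (1 - lam) * taup p₂ q - taup p₀ q) = fun q =>
        (lam * auxY t₁ q + (1 - lam) * auxY t₂ q - auxY t₀ q) / Real.log 2 := funext htau
      rw [this]
      exact (continuous_iff_continuousAt.2 fun q => (hd q).continuousAt).div_const _
    have h1 : (1 + q₀) / 2 ≤ q₀ + 1 := by linarith
    have hA := hlt ((1 + q₀) / 2) (by linarith) (by linarith)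
    have hB := hgt (q₀ + 1) (by linarith)
    obtain ⟨x, hx, hx0⟩ := intermediate_value_Icc' h1 hcont.continuousOn
      (show (0 : ℝ) ∈ _ from ⟨by linarith, by linarith⟩)
    exact h x (by linarith [hx.1]) (by linarith)
  · refine Or.inr ⟨?_, h⟩
    push Not at h
    obtain ⟨q₀, hq₀, he⟩ := h
    have h0 : lam * auxY t₁ q₀ + (1 - lam) * auxY t₂ q₀ - auxY t₀ q₀ = 0 := by
      have := htau q₀
      rw [he, sub_self, eq_comm, div_eq_zero_iff] at this
      exact this.resolve_right hlog2.ne'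
    have hL : ∀ q : ℝ, 1 < q → q < q₀ →
        taup p₀ q < lam * taup p₁ q + (1 - lam) * taup p₂ q := by
      intro q hq hqq
      have := aux_left _ _ q q₀ hqq (fun x _ => hd x)
        (fun x hx => hz x (lt_of_lt_of_le hq hx.1)) h0
      have := div_pos this hlog2
      rw [← htau] at this
      linarith
    have hR : ∀ q : ℝ, q₀ < q → lam * taup p₁ q + (1 - lam) * taup p₂ q < taup p₀ q := by
      intro q hqq
      have := aux_right _ _ q₀ q hqq (fun x _ => hd x)
        (fun x hx => hz x (lt_of_lt_of_le hq₀ hx.1)) h0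
      have := div_neg_of_neg_of_pos this hlog2
      rw [← htau] at this
      linarith
    refine ⟨q₀, hq₀, hL, hR, ?_⟩
    intro q hq e
    rcases lt_trichotomy q q₀ with h | h | h
    · exact absurd e (hL q hq h).ne'
    · exact h
    · exact absurd e (hR q h).ne
end
end

section
/- Let λ_1, λ_2 ∈ (0,1) with λ_1 + λ_2 = 1, let 0 < p_1 < p_2 < 1/2, and set τ = λ_1 τ(p_1,·) + λ_2 τ(p_2,·). Fix 1 < q_1 < q_2 < ∞, let p_4 ∈ (p_1,p_2) be such that τ(p_4,q_1) = τ(q_1), and let p_5 ∈ (p_2,1/2). Then there is a unique triple (λ_3,λ_4,λ_5) of positive reals with λ_3 + λ_4 + λ_5 = 1 such that τ̃ = λ_3 τ(p_1,·) + λ_4 τ(p_4,·) + λ_5 τ(p_5,·) satisfies τ̃(q_1) = τ(q_1) and τ̃(q_2) = τ(q_2). Furthermore, τ̃'(q_i) ≠ τ'(q_i) for i = 1,2, and τ̃(q) ≠ τ(q) for every q > 1 with q ∉ {q_1,q_2}. -/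
open MeasureTheory Filter Set

noncomputable section

lemma cauchy_slope (f g f' g' : ℝ → ℝ) {a b c : ℝ} (hab : a < b) (hbc : b < c)
    (hf : ∀ x ∈ Icc a c, HasDerivAt f (f' x) x) (hg : ∀ x ∈ Icc a c, HasDerivAt g (g' x) x)
    (hpos : ∀ x ∈ Icc a c, 0 < g' x)
    (hanti : ∀ x ∈ Icc a c, ∀ y ∈ Icc a c, x < y → f' y / g' y < f' x / g' x) :
    g a < g b ∧ g b < g c ∧ (f c - f b) * (g b - g a) < (f b - f a) * (g c - g b) := by
  have key : ∀ u v, a ≤ u → u < v → v ≤ c → g u < g v ∧ ∃ x ∈ Ioo u v,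
      (f v - f u) = f' x / g' x * (g v - g u) := by
    intro u v hu huv hv
    have sub : ∀ x ∈ Icc u v, x ∈ Icc a c := fun x hx => ⟨hu.trans hx.1, hx.2.trans hv⟩
    have fc : ContinuousOn f (Icc u v) := fun x hx => (hf x (sub x hx)).continuousAt.continuousWithinAt
    have gc : ContinuousOn g (Icc u v) := fun x hx => (hg x (sub x hx)).continuousAt.continuousWithinAt
    constructor
    · obtain ⟨x, hx, h⟩ := exists_hasDerivAt_eq_slope g g' huv gc
        (fun x hx => hg x (sub x (Ioo_subset_Icc_self hx)))
      have := hpos x (sub x (Ioo_subset_Icc_self hx))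
      rw [h] at this
      have h2 : 0 < v - u := by linarith
      have := (div_pos_iff_of_pos_right h2).1 this
      linarith
    · obtain ⟨x, hx, h⟩ := exists_ratio_hasDerivAt_eq_ratio_slope f f' huv fc
        (fun x hx => hf x (sub x (Ioo_subset_Icc_self hx))) g g' gc
        (fun x hx => hg x (sub x (Ioo_subset_Icc_self hx)))
      refine ⟨x, hx, ?_⟩
      have := hpos x (sub x (Ioo_subset_Icc_self hx))
      field_simp
      linarith
  obtain ⟨h1, x, hx, e1⟩ := key a b le_rfl hab hbc.le
  obtain ⟨h2, y, hy, e2⟩ := key b c hab.le hbc le_rfl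
  refine ⟨h1, h2, ?_⟩
  have := hanti x ⟨hx.1.le, hx.2.le.trans hbc.le⟩ y ⟨hab.le.trans hy.1.le, hy.2.le⟩ (hx.2.trans hy.1)
  rw [e1, e2]
  have h3 : 0 < (g b - g a) * (g c - g b) := mul_pos (by linarith) (by linarith)
  nlinarith

lemma sinh_cubic {y : ℝ} (hy : 0 < y) : y + y^3/6 < Real.sinh y := by
  have h0 : ∀ x : ℝ, 0 < x → 1 + x^2/2 < Real.cosh x := by
    intro x hx
    have h1 := Real.cosh_two_mul (x/2)
    have h2 := Real.cosh_sq (x/2)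
    have h3 : x/2 < Real.sinh (x/2) := Real.self_lt_sinh_iff.2 (by linarith)
    rw [show 2 * (x/2) = x by ring] at h1
    nlinarith
  have hm : StrictMonoOn (fun x : ℝ => Real.sinh x - (x + x^3/6)) (Ici 0) := by
    apply strictMonoOn_of_deriv_pos (convex_Ici 0) (by fun_prop)
    intro x hx
    simp only [interior_Ici, mem_Ioi] at hx
    have : HasDerivAt (fun x : ℝ => Real.sinh x - (x + x^3/6)) (Real.cosh x - (1 + (3 * x^2)/6)) x := by
      have := (Real.hasDerivAt_sinh x).sub ((hasDerivAt_id x).add ((hasDerivAt_pow 3 x).div_const 6))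
      refine this.congr_deriv ?_
      norm_num
    rw [this.deriv]
    have := h0 x hx
    linarith
  have := hm (by simp : (0:ℝ) ∈ Ici 0) (by simpa using hy.le) hy
  simp at this
  linarith

lemma sinh_lt_mul_cosh {y : ℝ} (hy : 0 < y) : Real.sinh y < y * Real.cosh y := by
  have hm : StrictMonoOn (fun x : ℝ => x * Real.cosh x - Real.sinh x) (Ici 0) := by
    apply strictMonoOn_of_deriv_pos (convex_Ici 0) (by fun_prop)
    intro x hx
    simp only [interior_Ici, mem_Ioi] at hx
    have : HasDerivAt (fun x : ℝ => x * Real.cosh x - Real.sinh x) (1 * Real.cosh x + x * Real.sinh x - Real.cosh x) x :=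
      ((hasDerivAt_id x).mul (Real.hasDerivAt_cosh x)).sub (Real.hasDerivAt_sinh x)
    rw [this.deriv]
    have := mul_pos hx (Real.sinh_pos_iff.2 hx)
    linarith
  have := hm (by simp : (0:ℝ) ∈ Ici 0) (by simpa using hy.le) hy
  simp at this
  linarith

lemma key_ineq {y : ℝ} (hy : 0 < y) :
    (Real.sinh y - y) * (1 + Real.cosh y)^2 + y^2 * Real.sinh y * (1 + Real.cosh y)
      < 3 * (Real.sinh y + y)^3 := by
  have h1 := sinh_cubic hy
  have h2 := sinh_lt_mul_cosh hy
  have h3 := Real.cosh_sq y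
  have h4 := Real.one_lt_cosh.2 hy.ne'
  have hS : 0 < Real.sinh y := Real.sinh_pos_iff.2 hy
  set S := Real.sinh y
  set C := Real.cosh y
  have hyS : y < S := by have : 0 < y^3 := by positivity
                         linarith
  have hC1 : C ≤ 1 + S := by nlinarith
  have hC2 : C - 1 ≤ S^2/2 := by nlinarith
  have a1 : (1 + C)^2 ≤ 4 + 2*S^2 := by nlinarith [sq_nonneg (C-1)]
  have a2 : (S - y) * (1+C)^2 ≤ (S-y)*(4+2*S^2) := mul_le_mul_of_nonneg_left a1 (by linarith)
  have a3 : S - y ≤ y * (S^2/2) := by nlinarith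
  have a4 : y^2 ≤ S + 9*y := by nlinarith [mul_nonneg hy.le (sq_nonneg (y-3))]
  have a5 : y^2*S*(1+C) ≤ y^2*S*(2+S) := mul_le_mul_of_nonneg_left (by linarith) (by positivity)
  have a6 : y^2*S^2 ≤ (S+9*y)*S^2 := mul_le_mul_of_nonneg_right a4 (by positivity)
  have a7 : 0 < S*y^2 := by positivity
  have a8 : 0 < y^3 := by positivity
  nlinarith

/-- `v x = 2 x tanh x` -/
def vv (x : ℝ) : ℝ := 2 * x * Real.sinh x / Real.cosh x
def vd (x : ℝ) : ℝ := 2 * (Real.sinh x * Real.cosh x + x) / Real.cosh x ^ 2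

lemma vv_deriv (x : ℝ) : HasDerivAt vv (vd x) x := by
  have hc := (Real.cosh_pos x).ne'
  have h := ((((hasDerivAt_id x).const_mul 2).mul (Real.hasDerivAt_sinh x)).div (Real.hasDerivAt_cosh x) hc)
  refine h.congr_deriv ?_
  have := Real.cosh_sq x
  simp only [vd, id, Pi.mul_apply]
  field_simp
  linear_combination x * this

lemma vd_pos {x : ℝ} (hx : 0 < x) : 0 < vd x := by
  have := Real.cosh_pos x
  have := Real.sinh_pos_iff.2 hx
  unfold vd; positivity

def NN (x : ℝ) : ℝ := 2 * x * Real.cosh x ^ 2 / (Real.sinh x * Real.cosh x + x) - 3 * vv x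

lemma NN_anti : StrictAntiOn NN (Ioi 0) := by
  have hd : ∀ x ∈ Ioi (0:ℝ), HasDerivAt NN (2 * Real.cosh x * (Real.sinh x * Real.cosh x^2 - x * Real.cosh x + 2 * x^2 * Real.sinh x) / (Real.sinh x * Real.cosh x + x)^2 - 3 * vd x) x := by
    intro x hx
    have hx' : 0 < x := hx
    have hc := Real.cosh_pos x
    have hs := Real.sinh_pos_iff.2 hx'
    have hne : Real.sinh x * Real.cosh x + x ≠ 0 := by positivity
    have h := ((((hasDerivAt_id x).const_mul 2).mul ((Real.hasDerivAt_cosh x).pow 2)).div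
      (((Real.hasDerivAt_sinh x).mul (Real.hasDerivAt_cosh x)).add (hasDerivAt_id x)) hne).sub
      ((vv_deriv x).const_mul 3)
    refine h.congr_deriv ?_
    congr 1
    simp only [id, Pi.mul_apply, Pi.add_apply, Pi.pow_apply]
    congr 1
    have h2 : Real.sinh x ^2 = Real.cosh x^2 - 1 := by rw [Real.cosh_sq x]; ring
    push_cast
    generalize Real.sinh x = s at *
    generalize Real.cosh x = c at *
    norm_num
    linear_combination (2 * x * c^2) * h2
  apply strictAntiOn_of_deriv_neg (convex_Ioi 0) (fun x hx => (hd x hx).continuousAt.continuousWithinAt)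
  intro x hx
  rw [interior_Ioi] at hx
  rw [(hd x hx).deriv]
  have hx' : 0 < x := hx
  have hc := Real.cosh_pos x
  have hs := Real.sinh_pos_iff.2 hx'
  have k := key_ineq (y := 2 * x) (by linarith)
  rw [Real.sinh_two_mul, Real.cosh_two_mul] at k
  have h2 : Real.sinh x ^2 = Real.cosh x^2 - 1 := by rw [Real.cosh_sq x]; ring
  rw [h2] at k
  unfold vd
  generalize Real.sinh x = s at *
  generalize Real.cosh x = c at *
  rw [sub_neg, ← mul_div_assoc, div_lt_div_iff₀ (by positivity) (by positivity)]
  have e : (1 + (c^2 + (c^2-1))) = 2*c^2 := by ring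
  rw [e] at k
  nlinarith

/-- slope inequality -/
lemma slope3 {x y z : ℝ} (hx : 0 < x) (hxy : x < y) (hyz : y < z) :
    vv x < vv y ∧ vv y < vv z ∧
    ((z * vd z - vv z^2) - (x * vd x - vv x^2)) * (vv y - vv x)
     < ((y * vd y - vv y^2) - (x * vd x - vv x^2)) * (vv z - vv x) := by
  have hG : ∀ x, x * vd x - vv x^2 = vv x + 2 * x^2 - 3/2 * vv x^2 := by
    intro x
    unfold vd vv
    have hc := Real.cosh_pos x
    have h2 : Real.sinh x ^2 = Real.cosh x^2 - 1 := by rw [Real.cosh_sq x]; ring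
    field_simp
    rw [h2]; ring
  have := cauchy_slope (fun x => vv x + 2 * x^2 - 3/2 * vv x^2) vv
    (fun x => vd x + 4 * x - 3 * vv x * vd x) vd hxy hyz ?_ (fun x _ => vv_deriv x) ?_ ?_
  · obtain ⟨h1, h2, h3⟩ := this
    refine ⟨h1, h2, ?_⟩
    simp only [← hG] at h3
    nlinarith
  · intro x _
    refine (((vv_deriv x).add ((hasDerivAt_pow 2 x).const_mul 2)).sub (((vv_deriv x).pow 2).const_mul (3/2))).congr_deriv ?_
    norm_num; ring
  · intro u hu; exact vd_pos (hx.trans_le hu.1)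
  · intro u hu w hw huw
    have e : ∀ u, 0 < u → (vd u + 4 * u - 3 * vv u * vd u)/vd u = 1 + NN u := by
      intro u hu
      have h := (vd_pos hu).ne'
      have : 4 * u / vd u = 2 * u * Real.cosh u ^ 2 / (Real.sinh u * Real.cosh u + u) := by
        have := Real.cosh_pos u
        have := Real.sinh_pos_iff.2 hu
        unfold vd
        field_simp; ring
      rw [NN, ← this]
      field_simp
      ring
    have hu0 := hx.trans_le hu.1
    have hw0 := hx.trans_le hw.1
    rw [e u hu0, e w hw0]
    have := NN_anti hu0 hw0 huw
    linarith

lemma F_deriv (y1 y s : ℝ) :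
    HasDerivAt (fun s => (vv (y * s) - vv (y1 * s)) / Real.cosh (y * s)^2)
      (((y * vd (y*s) - y1 * vd (y1 * s)) - (vv (y*s) - vv (y1*s)) * (2 * y * Real.sinh (y*s) / Real.cosh (y*s))) / Real.cosh (y*s)^2) s := by
  have hc := Real.cosh_pos (y*s)
  have l : ∀ y : ℝ, HasDerivAt (fun s : ℝ => y * s) y s := fun y => by
    simpa using (hasDerivAt_id s).const_mul y
  have hv : ∀ y : ℝ, HasDerivAt (fun s => vv (y * s)) (vd (y*s) * y) s := fun y =>
    (vv_deriv (y*s)).comp s (l y)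
  have hcd : HasDerivAt (fun s => Real.cosh (y * s)) (Real.sinh (y*s) * y) s :=
    (Real.hasDerivAt_cosh (y*s)).comp s (l y)
  refine (((hv y).sub (hv y1)).div (hcd.pow 2) (pow_pos hc 2).ne').congr_deriv ?_
  simp only [Pi.sub_apply, Pi.pow_apply]
  field_simp
  norm_num
  ring

lemma rho_deriv (y1 y s : ℝ) (hs : s ≠ 0) :
    HasDerivAt (fun s => Real.cosh (y1 * s)^2 / Real.cosh (y * s)^2)
      (-(Real.cosh (y1*s)^2 / s * ((vv (y * s) - vv (y1 * s)) / Real.cosh (y * s)^2))) s := by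
  have hc := Real.cosh_pos (y*s)
  have hc1 := Real.cosh_pos (y1*s)
  have l : ∀ y : ℝ, HasDerivAt (fun s : ℝ => y * s) y s := fun y => by
    simpa using (hasDerivAt_id s).const_mul y
  have hcd : ∀ y : ℝ, HasDerivAt (fun s => Real.cosh (y * s)) (Real.sinh (y*s) * y) s := fun y =>
    (Real.hasDerivAt_cosh (y*s)).comp s (l y)
  refine (((hcd y1).pow 2).div ((hcd y).pow 2) (pow_pos hc 2).ne').congr_deriv ?_
  simp only [Pi.pow_apply, vv]
  field_simp
  norm_num
  ring

lemma tp3 {y1 y2 y3 : ℝ} (h1 : 0 < y1) (h12 : y1 < y2) (h23 : y2 < y3) (a1 a2 a3 : ℝ)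
    {t1 t2 t3 : ℝ} (ht1 : 0 < t1) (ht12 : t1 < t2) (ht23 : t2 < t3)
    (hz : ∀ t, t = t1 ∨ t = t2 ∨ t = t3 →
      a1 / Real.cosh (y1 * t)^2 + a2 / Real.cosh (y2 * t)^2 + a3 / Real.cosh (y3 * t)^2 = 0) :
    a1 = 0 ∧ a2 = 0 ∧ a3 = 0 := by
  set F : ℝ → ℝ → ℝ := fun y s => (vv (y * s) - vv (y1 * s)) / Real.cosh (y * s)^2 with hF
  have sl : ∀ s : ℝ, 0 < s → _ := fun s hs => slope3 (x := y1 * s) (y := y2 * s) (z := y3 * s)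
    (by positivity) (by gcongr) (by gcongr)
  have F2 : ∀ s, 0 < s → 0 < F y2 s := fun s hs =>
    div_pos (by have := (sl s hs).1; linarith) (by have := Real.cosh_pos (y2 * s); positivity)
  -- first Rolle
  have rolle1 : ∀ u w, 0 < u → u < w → (u = t1 ∨ u = t2 ∨ u = t3) → (w = t1 ∨ w = t2 ∨ w = t3) →
      ∃ s ∈ Ioo u w, a2 * F y2 s + a3 * F y3 s = 0 := by
    intro u w hu huw hu' hw'
    have hd : ∀ s, 0 < s → HasDerivAt (fun s => a1 + a2 * (Real.cosh (y1 * s)^2 / Real.cosh (y2 * s)^2) + a3 * (Real.cosh (y1 * s)^2 / Real.cosh (y3 * s)^2))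
       (a2 * (-(Real.cosh (y1*s)^2 / s * F y2 s)) + a3 * (-(Real.cosh (y1*s)^2 / s * F y3 s))) s := by
      intro s hs
      exact (((rho_deriv y1 y2 s hs.ne').const_mul a2).const_add a1).add ((rho_deriv y1 y3 s hs.ne').const_mul a3)
    have hzero : ∀ t, (t = t1 ∨ t = t2 ∨ t = t3) → a1 + a2 * (Real.cosh (y1 * t)^2 / Real.cosh (y2 * t)^2) + a3 * (Real.cosh (y1 * t)^2 / Real.cosh (y3 * t)^2) = 0 := by
      intro t ht
      have h := hz t ht
      have hc := Real.cosh_pos (y1 * t)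
      have : a1 + a2 * (Real.cosh (y1 * t)^2 / Real.cosh (y2 * t)^2) + a3 * (Real.cosh (y1 * t)^2 / Real.cosh (y3 * t)^2) = Real.cosh (y1*t)^2 * (a1 / Real.cosh (y1 * t)^2 + a2 / Real.cosh (y2 * t)^2 + a3 / Real.cosh (y3 * t)^2) := by
        field_simp
      rw [this, h, mul_zero]
    obtain ⟨s, hs, h⟩ := exists_hasDerivAt_eq_zero huw
      (fun s hs => (hd s (hu.trans_le hs.1)).continuousAt.continuousWithinAt)
      ((hzero u hu').trans (hzero w hw').symm) (fun s hs => hd s (hu.trans hs.1))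
    refine ⟨s, hs, ?_⟩
    have hs0 := hu.trans hs.1
    have hc := Real.cosh_pos (y1 * s)
    have hp : 0 < Real.cosh (y1*s)^2 / s := by positivity
    have : Real.cosh (y1*s)^2 / s * (a2 * F y2 s + a3 * F y3 s) = 0 := by linarith
    exact (mul_eq_zero.1 this).resolve_left hp.ne'
  obtain ⟨s1, hs1, e1⟩ := rolle1 t1 t2 ht1 ht12 (by simp) (by simp)
  obtain ⟨s2, hs2, e2⟩ := rolle1 t2 t3 (ht1.trans ht12) ht23 (by simp) (by simp)
  have s10 : 0 < s1 := ht1.trans hs1.1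
  have s12 : s1 < s2 := hs1.2.trans hs2.1
  have a3z : a3 = 0 := by
    by_contra ha3
    have hdiv : ∀ s, 0 < s → a2 * F y2 s + a3 * F y3 s = 0 → F y3 s / F y2 s = - a2 / a3 := by
      intro s hs h
      have := (F2 s hs).ne'
      field_simp
      linarith
    obtain ⟨s, hs, h⟩ := exists_hasDerivAt_eq_zero (f := fun s => F y3 s / F y2 s) s12
      (fun s hs => ((F_deriv y1 y3 s).div (F_deriv y1 y2 s) (F2 s (s10.trans_le hs.1)).ne').continuousAt.continuousWithinAt)
      ((hdiv s1 s10 e1).trans (hdiv s2 (s10.trans s12) e2).symm)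
      (fun s hs => (F_deriv y1 y3 s).div (F_deriv y1 y2 s) (F2 s (s10.trans hs.1)).ne')
    have s0 := s10.trans hs.1
    obtain ⟨l1, l2, l3⟩ := sl s s0
    rw [div_eq_zero_iff] at h
    have h := h.resolve_right (by have := F2 s s0; simp only [hF] at this; positivity)
    have q2 : 2 * y2 * Real.sinh (y2*s) / Real.cosh (y2*s) = vv (y2 * s) / s := by
      unfold vv; field_simp
    have q3 : 2 * y3 * Real.sinh (y3*s) / Real.cosh (y3*s) = vv (y3 * s) / s := by
      unfold vv; field_simp
    rw [q2, q3] at h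
    simp only [hF] at h
    have c2 := Real.cosh_pos (y2 * s)
    have c3 := Real.cosh_pos (y3 * s)
    generalize Real.cosh (y2 * s) = C2 at *
    generalize Real.cosh (y3 * s) = C3 at *
    generalize vv (y1 * s) = v1 at *
    generalize vv (y2 * s) = v2 at *
    generalize vv (y3 * s) = v3 at *
    generalize vd (y1 * s) = d1 at *
    generalize vd (y2 * s) = d2 at *
    generalize vd (y3 * s) = d3 at *
    field_simp at h
    have g12 : 0 < v2 - v1 := by linarith
    have g13 : 0 < v3 - v1 := by linarith
    nlinarith
  subst a3z
  have a2z : a2 = 0 := by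
    have := (F2 s1 s10).ne'
    simpa [this] using e1
  subst a2z
  have := hz t1 (by simp)
  have hc := (Real.cosh_pos (y1 * t1)).ne'
  simpa [hc] using this

def HH (x : ℝ) : ℝ := vv x / 2 - Real.log (Real.cosh x)

lemma HH_deriv (x : ℝ) : HasDerivAt HH (x / Real.cosh x^2) x := by
  have hc := Real.cosh_pos x
  refine (((vv_deriv x).div_const 2).sub ((Real.hasDerivAt_cosh x).log hc.ne')).congr_deriv ?_
  unfold vd
  field_simp
  ring

lemma HH_deriv' (q t : ℝ) : HasDerivAt (fun t => HH (q * t)) (q^2 * t / Real.cosh (q * t)^2) t := by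
  have l : HasDerivAt (fun s : ℝ => q * s) q t := by simpa using (hasDerivAt_id t).const_mul q
  refine ((HH_deriv (q*t)).comp t l).congr_deriv ?_
  ring

/-- no three positive zeros -/
lemma no3 (c u : Fin 4 → ℝ) (hc : c ≠ 0) (hsum : ∑ i, c i = 0) (hu0 : 0 < u 0)
    (hu : StrictMono u) {x1 x2 x3 : ℝ} (hx1 : 0 < x1) (hx12 : x1 < x2) (hx23 : x2 < x3)
    (z1 : ∑ i, c i * HH (x1 * u i) = 0) (z2 : ∑ i, c i * HH (x2 * u i) = 0)
    (z3 : ∑ i, c i * HH (x3 * u i) = 0) : False := by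
  let N : Matrix (Fin 4) (Fin 4) ℝ := fun j i => ![1, HH (x1 * u i), HH (x2 * u i), HH (x3 * u i)] j
  have hN : N.mulVec c = 0 := by
    funext j
    fin_cases j <;> simp [Matrix.mulVec, dotProduct, N, mul_comm _ (c _), hsum, z1, z2, z3]
  have hdet : N.det = 0 := Matrix.exists_mulVec_eq_zero_iff.1 ⟨c, hc, hN⟩
  obtain ⟨a, ha, hNa⟩ := Matrix.exists_vecMul_eq_zero_iff.2 hdet
  have ez : ∀ i, a 0 + a 1 * HH (x1 * u i) + a 2 * HH (x2 * u i) + a 3 * HH (x3 * u i) = 0 := by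
    intro i
    have := congrFun hNa i
    simpa [Matrix.vecMul, dotProduct, N, Fin.sum_univ_four] using this
  have rolle : ∀ i j, u i < u j → 0 < u i → ∃ t ∈ Ioo (u i) (u j),
      (a 1 * x1^2) / Real.cosh (x1 * t)^2 + (a 2 * x2^2) / Real.cosh (x2 * t)^2 + (a 3 * x3^2) / Real.cosh (x3 * t)^2 = 0 := by
    intro i j hij hi
    have hd : ∀ t, HasDerivAt (fun t => a 0 + a 1 * HH (x1 * t) + a 2 * HH (x2 * t) + a 3 * HH (x3 * t))
        (a 1 * (x1^2 * t / Real.cosh (x1 * t)^2) + a 2 * (x2^2 * t / Real.cosh (x2 * t)^2) + a 3 * (x3^2 * t / Real.cosh (x3 * t)^2)) t := fun t =>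
      ((((HH_deriv' x1 t).const_mul (a 1)).const_add (a 0)).add ((HH_deriv' x2 t).const_mul (a 2))).add ((HH_deriv' x3 t).const_mul (a 3))
    obtain ⟨t, ht, h⟩ := exists_hasDerivAt_eq_zero hij
      (fun t _ => (hd t).continuousAt.continuousWithinAt)
      ((ez i).trans (ez j).symm) (fun t _ => hd t)
    refine ⟨t, ht, ?_⟩
    have t0 : t ≠ 0 := (hi.trans ht.1).ne'
    refine (mul_eq_zero.1 (?_ : t * _ = 0)).resolve_left t0
    rw [← h]; ring
  have u01 : u 0 < u 1 := hu (by decide)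
  have u12 : u 1 < u 2 := hu (by decide)
  have u23 : u 2 < u 3 := hu (by decide)
  obtain ⟨t1, k1, e1⟩ := rolle 0 1 u01 hu0
  obtain ⟨t2, k2, e2⟩ := rolle 1 2 u12 (by linarith)
  obtain ⟨t3, k3, e3⟩ := rolle 2 3 u23 (by linarith)
  obtain ⟨b1, b2, b3⟩ := tp3 hx1 hx12 hx23 _ _ _ (hu0.trans k1.1) (k1.2.trans k2.1) (k2.2.trans k3.1)
    (by rintro t (rfl | rfl | rfl) <;> assumption)
  have n1 : x1 ≠ 0 := by positivity
  have n2 : x2 ≠ 0 := by linarith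
  have n3 : x3 ≠ 0 := by linarith
  simp [n1, n2, n3] at b1 b2 b3
  have b0 := ez 0
  simp [b1, b2, b3] at b0
  apply ha
  funext j
  fin_cases j <;> simp [b0, b1, b2, b3]

/-- single crossing -/
lemma cross {ta tb tc α γ x q : ℝ} (hc : 0 < tc) (hcb : tc < tb) (hba : tb < ta)
    (hα : 0 < α) (hγ : 0 < γ) (hx : 0 < x) (hxq : x < q)
    (hz : α * HH (x * ta) + γ * HH (x * tc) - (α + γ) * HH (x * tb) = 0) :
    α * HH (q * ta) + γ * HH (q * tc) - (α + γ) * HH (q * tb) < 0 := by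
  have hq := hx.trans hxq
  have main := cauchy_slope (fun t => HH (q * t)) (fun t => HH (x * t))
    (fun t => q^2 * t / Real.cosh (q * t)^2) (fun t => x^2 * t / Real.cosh (x * t)^2) hcb hba
    (fun t _ => HH_deriv' q t) (fun t _ => HH_deriv' x t) ?_ ?_
  · obtain ⟨h1, h2, h3⟩ := main
    have e : α * (HH (x * ta) - HH (x*tb)) = γ * (HH (x*tb) - HH (x*tc)) := by linarith
    have p : 0 < HH (x*tb) - HH (x*tc) := by linarith
    have h4 := mul_lt_mul_of_pos_left h3 hα
    have h5 : (HH (x*tb) - HH (x*tc)) * (α * (HH (q*ta) - HH (q*tb))) < (HH (x*tb) - HH (x*tc)) * (γ * (HH (q*tb) - HH (q*tc))) := by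
      calc _ = α * ((HH (q * ta) - HH (q * tb)) * (HH (x * tb) - HH (x * tc))) := by ring
        _ < _ := h4
        _ = (HH (q * tb) - HH (q * tc)) * (α * (HH (x * ta) - HH (x * tb))) := by ring
        _ = _ := by rw [e]; ring
    have := lt_of_mul_lt_mul_left h5 p.le
    linarith
  · intro t ht
    have := hc.trans_le ht.1
    have := Real.cosh_pos (x*t)
    positivity
  · intro s hs t ht hst
    have s0 := hc.trans_le hs.1
    have t0 := hc.trans_le ht.1
    have e : ∀ t, 0 < t → q^2 * t / Real.cosh (q * t)^2 / (x^2 * t / Real.cosh (x * t)^2) = (q^2/x^2) * (Real.cosh (x*t)^2 / Real.cosh (q*t)^2) := by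
      intro t ht
      field_simp
    rw [e s s0, e t t0]
    apply mul_lt_mul_of_pos_left _ (by positivity)
    have anti : StrictAntiOn (fun s => Real.cosh (x * s)^2 / Real.cosh (q * s)^2) (Ioi 0) := by
      apply strictAntiOn_of_deriv_neg (convex_Ioi 0) (fun s hs => (rho_deriv x q s (ne_of_gt hs)).continuousAt.continuousWithinAt)
      intro s hs
      rw [interior_Ioi] at hs
      have hs : 0 < s := hs
      rw [(rho_deriv x q s hs.ne').deriv]
      have c1 := Real.cosh_pos (x*s)
      have c2 := Real.cosh_pos (q*s)
      have := (slope3 (x := x * s) (y := q * s) (z := q * s + 1) (by positivity) (by gcongr) (by linarith)).1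
      have : 0 < vv (q*s) - vv (x*s) := by linarith
      rw [neg_lt_zero]
      positivity
    exact anti s0 t0 hst

def tt (p : ℝ) : ℝ := (Real.log (1 - p) - Real.log p) / 2
def bb (p : ℝ) : ℝ := (Real.log (1 - p) + Real.log p) / 2

lemma tt_anti {p p' : ℝ} (hp : 0 < p) (h : p < p') (hp' : p' < 1 / 2) : tt p' < tt p := by
  have h1 := Real.log_lt_log hp h
  have h2 := Real.log_lt_log (by linarith : 0 < 1 - p') (by linarith : 1 - p' < 1 - p)
  unfold tt; linarith

lemma tt_pos {p : ℝ} (hp : 0 < p) (hp' : p < 1 / 2) : 0 < tt p := by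
  have h1 := Real.log_lt_log hp (by linarith : p < 1 - p)
  unfold tt; linarith

lemma taup_eq {p : ℝ} (hp : 0 < p) (hp' : p < 1 / 2) (q : ℝ) :
    taup p q = (q * bb p + Real.log 2 + Real.log (Real.cosh (q * tt p))) / Real.log 2 := by
  have h : p ^ q + (1 - p) ^ q = Real.exp (q * bb p) * (2 * Real.cosh (q * tt p)) := by
    rw [Real.rpow_def_of_pos hp, Real.rpow_def_of_pos (by linarith), Real.cosh_eq, bb, tt]
    rw [mul_div_cancel₀ _ (two_ne_zero), mul_add, ← Real.exp_add, ← Real.exp_add, add_comm]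
    congr 2 <;> ring
  have hc := Real.cosh_pos (q * tt p)
  rw [taup, h, Real.log_mul (Real.exp_pos _).ne' (by positivity), Real.log_mul (by norm_num) hc.ne',
    Real.log_exp, add_assoc]

lemma taup_one (p : ℝ) : taup p 1 = 0 := by simp [taup]

lemma taup_deriv {p : ℝ} (hp : 0 < p) (hp' : p < 1 / 2) (q : ℝ) :
    HasDerivAt (taup p) ((bb p + Real.sinh (q * tt p) * tt p / Real.cosh (q * tt p)) / Real.log 2) q := by
  have hc := Real.cosh_pos (q * tt p)
  have e : taup p = fun q => (q * bb p + Real.log 2 + Real.log (Real.cosh (q * tt p))) / Real.log 2 :=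
    funext (taup_eq hp hp')
  rw [e]
  have l : ∀ t : ℝ, HasDerivAt (fun s : ℝ => s * t) t q := fun t => by
    simpa using (hasDerivAt_id q).mul_const t
  have hcd : HasDerivAt (fun s => Real.cosh (s * tt p)) (Real.sinh (q * tt p) * tt p) q :=
    HasDerivAt.comp (h₂ := Real.cosh) q (Real.hasDerivAt_cosh (q * tt p)) (l (tt p))
  exact (((l (bb p)).add_const (Real.log 2)).add (hcd.log hc.ne')).div_const _

lemma taup_div_deriv {p : ℝ} (hp : 0 < p) (hp' : p < 1 / 2) {q : ℝ} (hq : 0 < q) :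
    HasDerivAt (fun q => taup p q / q) ((HH (q * tt p) - Real.log 2) / (q^2 * Real.log 2)) q := by
  have hc := Real.cosh_pos (q * tt p)
  have hl : 0 < Real.log 2 := Real.log_pos (by norm_num)
  refine ((taup_deriv hp hp' q).div (hasDerivAt_id q) hq.ne').congr_deriv ?_
  rw [taup_eq hp hp', HH, vv]
  simp only [id]
  field_simp
  ring

def DD (c P : Fin 4 → ℝ) (q : ℝ) : ℝ := ∑ i, c i * taup (P i) q

lemma DD_div_deriv (c P : Fin 4 → ℝ) (hP : ∀ i, 0 < P i ∧ P i < 1 / 2) (hsum : ∑ i, c i = 0)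
    {q : ℝ} (hq : 0 < q) : HasDerivAt (fun q => DD c P q / q)
      ((∑ i, c i * HH (q * tt (P i))) / (q^2 * Real.log 2)) q := by
  have e : (fun q => DD c P q / q) = fun q => ∑ i, c i * (taup (P i) q / q) := by
    funext q; simp only [DD, Finset.sum_div, mul_div_assoc]
  rw [e]
  have h := HasDerivAt.fun_sum (u := Finset.univ) (fun i _ =>
    (taup_div_deriv (hP i).1 (hP i).2 hq).const_mul (c i))
  refine h.congr_deriv ?_
  have : (∑ i, c i * HH (q * tt (P i))) = ∑ i, c i * (HH (q * tt (P i)) - Real.log 2) := by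
    simp only [mul_sub, Finset.sum_sub_distrib, ← Finset.sum_mul, hsum]; ring
  rw [this, Finset.sum_div]
  simp only [mul_div_assoc]

lemma DD_one (c P : Fin 4 → ℝ) : DD c P 1 = 0 := by simp [DD, taup_one]

lemma DD_rolle (c P : Fin 4 → ℝ) (hP : ∀ i, 0 < P i ∧ P i < 1 / 2) (hsum : ∑ i, c i = 0)
    {a b : ℝ} (ha : 0 < a) (hab : a < b) (za : DD c P a = 0) (zb : DD c P b = 0) :
    ∃ x ∈ Ioo a b, ∑ i, c i * HH (x * tt (P i)) = 0 := by
  have hl : 0 < Real.log 2 := Real.log_pos (by norm_num)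
  obtain ⟨x, hx, h⟩ := exists_hasDerivAt_eq_zero (f := fun q => DD c P q / q) hab
    (fun q hq => (DD_div_deriv c P hP hsum (ha.trans_le hq.1)).continuousAt.continuousWithinAt)
    (by simp [za, zb]) (fun q hq => DD_div_deriv c P hP hsum (ha.trans hq.1))
  refine ⟨x, hx, ?_⟩
  have := ha.trans hx.1
  exact (div_eq_zero_iff.1 h).resolve_right (by positivity)

lemma DD_double (c P : Fin 4 → ℝ) (hP : ∀ i, 0 < P i ∧ P i < 1 / 2) (hsum : ∑ i, c i = 0)
    {a : ℝ} (ha : 0 < a) (za : DD c P a = 0) (zd : HasDerivAt (DD c P) 0 a) :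
    ∑ i, c i * HH (a * tt (P i)) = 0 := by
  have hl : 0 < Real.log 2 := Real.log_pos (by norm_num)
  have h1 := zd.div (hasDerivAt_id a) ha.ne'
  have h := (DD_div_deriv c P hP hsum ha).unique h1
  simp [za] at h
  have : a ≠ 0 := ha.ne'
  have h2 : Real.log 2 ≠ 0 := hl.ne'
  rcases h with h | h
  · exact h
  · norm_num at h
    exact absurd h this

section
variable (c P : Fin 4 → ℝ)

lemma DD_no3 (hP : ∀ i, 0 < P i ∧ P i < 1 / 2) (hanti : StrictAnti P) (hc : c ≠ 0)
    (hsum : ∑ i, c i = 0) {x1 x2 x3 : ℝ} (hx1 : 0 < x1) (hx12 : x1 < x2) (hx23 : x2 < x3)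
    (z1 : ∑ i, c i * HH (x1 * tt (P i)) = 0) (z2 : ∑ i, c i * HH (x2 * tt (P i)) = 0)
    (z3 : ∑ i, c i * HH (x3 * tt (P i)) = 0) : False :=
  no3 c (fun i => tt (P i)) hc hsum (tt_pos (hP 0).1 (hP 0).2)
    (fun i j hij => tt_anti (hP j).1 (hanti hij) (hP i).2) hx1 hx12 hx23 z1 z2 z3

lemma DD_three (hP : ∀ i, 0 < P i ∧ P i < 1 / 2) (hanti : StrictAnti P) (hc : c ≠ 0)
    (hsum : ∑ i, c i = 0) {a b e : ℝ} (ha : 1 < a) (hab : a < b) (hbe : b < e)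
    (za : DD c P a = 0) (zb : DD c P b = 0) (ze : DD c P e = 0) : False := by
  obtain ⟨x1, h1, e1⟩ := DD_rolle c P hP hsum one_pos ha (DD_one c P) za
  obtain ⟨x2, h2, e2⟩ := DD_rolle c P hP hsum (by linarith) hab za zb
  obtain ⟨x3, h3, e3⟩ := DD_rolle c P hP hsum (by linarith) hbe zb ze
  exact DD_no3 c P hP hanti hc hsum (one_pos.trans h1.1) (h1.2.trans h2.1) (h2.2.trans h3.1) e1 e2 e3

lemma DD_dbl (hP : ∀ i, 0 < P i ∧ P i < 1 / 2) (hanti : StrictAnti P) (hc : c ≠ 0)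
    (hsum : ∑ i, c i = 0) {a b : ℝ} (ha : 1 < a) (hab : a < b)
    (za : DD c P a = 0) (zb : DD c P b = 0) : ¬ HasDerivAt (DD c P) 0 a ∧ ¬ HasDerivAt (DD c P) 0 b := by
  obtain ⟨x1, h1, e1⟩ := DD_rolle c P hP hsum one_pos ha (DD_one c P) za
  obtain ⟨x2, h2, e2⟩ := DD_rolle c P hP hsum (by linarith) hab za zb
  constructor
  · intro h
    have e3 := DD_double c P hP hsum (by linarith) za h
    exact DD_no3 c P hP hanti hc hsum (one_pos.trans h1.1) h1.2 h2.1 e1 e3 e2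
  · intro h
    have e3 := DD_double c P hP hsum (by linarith) zb h
    exact DD_no3 c P hP hanti hc hsum (one_pos.trans h1.1) (h1.2.trans h2.1) h2.2 e1 e2 e3
end

lemma three_neg {pa pb pc α γ q₁ q₂ : ℝ} (ha : 0 < pa) (hab : pa < pb) (hbc : pb < pc)
    (hc : pc < 1/2) (hα : 0 < α) (hγ : 0 < γ) (hq : 1 < q₁) (hq12 : q₁ < q₂)
    (hz : α * taup pa q₁ + γ * taup pc q₁ = (α + γ) * taup pb q₁) :
    α * taup pa q₂ + γ * taup pc q₂ - (α + γ) * taup pb q₂ < 0 := by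
  have hl : 0 < Real.log 2 := Real.log_pos (by norm_num)
  have hd : ∀ q : ℝ, 0 < q → HasDerivAt (fun q => α * (taup pa q / q) + γ * (taup pc q / q) - (α + γ) * (taup pb q / q))
      ((α * HH (q * tt pa) + γ * HH (q * tt pc) - (α + γ) * HH (q * tt pb)) / (q^2 * Real.log 2)) q := by
    intro q hq
    refine ((((taup_div_deriv ha (by linarith) hq).const_mul α).add
      ((taup_div_deriv (by linarith) hc hq).const_mul γ)).sub
      ((taup_div_deriv (by linarith) (by linarith) hq).const_mul (α + γ))).congr_deriv ?_
    field_simp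
    ring
  have z1 : α * (taup pa q₁ / q₁) + γ * (taup pc q₁ / q₁) - (α + γ) * (taup pb q₁ / q₁) = 0 := by
    have : α * (taup pa q₁ / q₁) + γ * (taup pc q₁ / q₁) - (α + γ) * (taup pb q₁ / q₁)
      = (α * taup pa q₁ + γ * taup pc q₁ - (α + γ) * taup pb q₁) / q₁ := by ring
    rw [this, hz]; simp
  obtain ⟨x, hx, h⟩ := exists_hasDerivAt_eq_zero hq
    (fun q hq => (hd q (one_pos.trans_le hq.1)).continuousAt.continuousWithinAt)
    (by rw [z1]; simp [taup_one]) (fun q hq => hd q (one_pos.trans hq.1))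
  have x0 := one_pos.trans hx.1
  have h := (div_eq_zero_iff.1 h).resolve_right (by positivity)
  obtain ⟨y, hy, e⟩ := exists_hasDerivAt_eq_slope _ _ hq12
    (fun q hq' => (hd q (by linarith [hq'.1])).continuousAt.continuousWithinAt)
    (fun q hq' => hd q (by linarith [hq'.1]))
  have y0 : 0 < y := by linarith [hy.1]
  have neg := cross (tt_pos (by linarith) hc) (tt_anti (by linarith) hbc hc) (tt_anti ha hab (by linarith))
    hα hγ x0 (hx.2.trans hy.1) h
  have n2 := div_neg_of_neg_of_pos neg (by positivity : 0 < y^2 * Real.log 2)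
  rw [e, z1, sub_zero] at n2
  have n3 : α * (taup pa q₂ / q₂) + γ * (taup pc q₂ / q₂) - (α + γ) * (taup pb q₂ / q₂) < 0 := by
    by_contra hcon
    push Not at hcon
    exact absurd (div_nonneg hcon (by linarith : 0 ≤ q₂ - q₁)) (not_le.2 n2)
  have q0 : 0 < q₂ := by linarith
  have : α * taup pa q₂ + γ * taup pc q₂ - (α + γ) * taup pb q₂
      = q₂ * (α * (taup pa q₂ / q₂) + γ * (taup pc q₂ / q₂) - (α + γ) * (taup pb q₂ / q₂)) := by
    field_simp
  rw [this]
  exact mul_neg_of_pos_of_neg q0 n3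

lemma taup_anti {p p' q : ℝ} (hp : 0 < p) (h : p < p') (hp' : p' < 1 / 2) (hq : 1 < q) :
    taup p' q < taup p q := by
  have hl : 0 < Real.log 2 := Real.log_pos (by norm_num)
  have hs := strictConvexOn_rpow hq
  have d : 0 < 1 - 2 * p := by linarith
  set w := (p' - p) / (1 - 2 * p) with hw
  have w0 : 0 < w := by apply div_pos <;> linarith
  have w1 : 0 < 1 - w := by
    rw [hw, sub_pos, div_lt_one d]; linarith
  have e : w * (1 - 2 * p) = p' - p := by rw [hw]; exact div_mul_cancel₀ _ d.ne'
  have i1 := hs.2 (x := p) (by simpa using hp.le) (y := 1 - p) (by simp; linarith) (by linarith) w1 w0 (by ring)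
  have i2 := hs.2 (x := p) (by simpa using hp.le) (y := 1 - p) (by simp; linarith) (by linarith) w0 w1 (by ring)
  simp only [smul_eq_mul] at i1 i2
  rw [show (1 - w) * p + w * (1 - p) = p' by linarith] at i1
  rw [show w * p + (1 - w) * (1 - p) = 1 - p' by linarith] at i2
  unfold taup
  apply div_lt_div_of_pos_right _ hl
  apply Real.log_lt_log
  · have := Real.rpow_pos_of_pos (hp.trans h) q
    have := Real.rpow_pos_of_pos (by linarith : 0 < 1 - p') q
    linarith
  · linarith

/-- Lemma 5.3. Let `λ₁,λ₂ ∈ (0,1)` with `λ₁ + λ₂ = 1`,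
`0 < p₁ < p₂ < 1/2`, `τ = λ₁ τ(p₁,·) + λ₂ τ(p₂,·)`, `1 < q₁ < q₂`, `p₄ ∈ (p₁,p₂)` with
`τ(p₄,q₁) = τ(q₁)` and `p₅ ∈ (p₂,1/2)`. Then there is a unique triple `(λ₃,λ₄,λ₅)` of
positive reals summing to `1` such that `τ̃ = λ₃ τ(p₁,·) + λ₄ τ(p₄,·) + λ₅ τ(p₅,·)`
agrees with `τ` at `q₁` and `q₂`; moreover `τ̃'(qᵢ) ≠ τ'(qᵢ)` for `i = 1,2` and
`τ̃(q) ≠ τ(q)` for every `q > 1` with `q ∉ {q₁,q₂}`. -/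
theorem statement17
    (lam₁ lam₂ p₁ p₂ p₄ p₅ q₁ q₂ : ℝ)
    (hl₁ : lam₁ ∈ Set.Ioo (0 : ℝ) 1) (hl₂ : lam₂ ∈ Set.Ioo (0 : ℝ) 1)
    (hlsum : lam₁ + lam₂ = 1)
    (hp₁ : 0 < p₁) (hp₁₂ : p₁ < p₂) (hp₂ : p₂ < 1 / 2)
    (hq₁ : 1 < q₁) (hq₁₂ : q₁ < q₂)
    (hp₄ : p₄ ∈ Set.Ioo p₁ p₂)
    (hp₄q₁ : taup p₄ q₁ = lam₁ * taup p₁ q₁ + lam₂ * taup p₂ q₁)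
    (hp₅ : p₅ ∈ Set.Ioo p₂ (1 / 2 : ℝ)) :
    ∃ lam₃ lam₄ lam₅ : ℝ,
      (0 < lam₃ ∧ 0 < lam₄ ∧ 0 < lam₅ ∧ lam₃ + lam₄ + lam₅ = 1
          ∧ lam₃ * taup p₁ q₁ + lam₄ * taup p₄ q₁ + lam₅ * taup p₅ q₁
              = lam₁ * taup p₁ q₁ + lam₂ * taup p₂ q₁
          ∧ lam₃ * taup p₁ q₂ + lam₄ * taup p₄ q₂ + lam₅ * taup p₅ q₂
              = lam₁ * taup p₁ q₂ + lam₂ * taup p₂ q₂)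
        ∧ (∀ l₃ l₄ l₅ : ℝ, 0 < l₃ → 0 < l₄ → 0 < l₅ → l₃ + l₄ + l₅ = 1 →
            l₃ * taup p₁ q₁ + l₄ * taup p₄ q₁ + l₅ * taup p₅ q₁
                = lam₁ * taup p₁ q₁ + lam₂ * taup p₂ q₁ →
            l₃ * taup p₁ q₂ + l₄ * taup p₄ q₂ + l₅ * taup p₅ q₂
                = lam₁ * taup p₁ q₂ + lam₂ * taup p₂ q₂ →
            l₃ = lam₃ ∧ l₄ = lam₄ ∧ l₅ = lam₅)
        ∧ deriv (fun q => lam₃ * taup p₁ q + lam₄ * taup p₄ q + lam₅ * taup p₅ q) q₁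
            ≠ deriv (fun q => lam₁ * taup p₁ q + lam₂ * taup p₂ q) q₁
        ∧ deriv (fun q => lam₃ * taup p₁ q + lam₄ * taup p₄ q + lam₅ * taup p₅ q) q₂
            ≠ deriv (fun q => lam₁ * taup p₁ q + lam₂ * taup p₂ q) q₂
        ∧ ∀ q : ℝ, 1 < q → q ≠ q₁ → q ≠ q₂ →
            lam₃ * taup p₁ q + lam₄ * taup p₄ q + lam₅ * taup p₅ q
              ≠ lam₁ * taup p₁ q + lam₂ * taup p₂ q := by
  obtain ⟨hp₄1, hp₄2⟩ := hp₄
  obtain ⟨hp₅1, hp₅2⟩ := hp₅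
  have m14 := taup_anti hp₁ hp₄1 (by linarith) hq₁
  have m42 := taup_anti (by linarith) hp₄2 (by linarith) hq₁
  have m25 := taup_anti (by linarith) hp₅1 (by linarith) hq₁
  -- μ
  set μ := (taup p₄ q₁ - taup p₅ q₁) / (taup p₁ q₁ - taup p₅ q₁) with hμ
  have dpos : 0 < taup p₁ q₁ - taup p₅ q₁ := by linarith
  have eμ : μ * (taup p₁ q₁ - taup p₅ q₁) = taup p₄ q₁ - taup p₅ q₁ := by
    rw [hμ]; field_simp
  have μ0 : 0 < μ := div_pos (by linarith) dpos
  have μ1 : 0 < 1 - μ := by rw [hμ, sub_pos, div_lt_one dpos]; linarith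
  have hB := three_neg hp₁ hp₄1 hp₄2 hp₂ hl₁.1 hl₂.1 hq₁ hq₁₂ (by rw [hlsum, hp₄q₁]; ring)
  have hA := three_neg hp₁ hp₄1 (hp₄2.trans hp₅1) hp₅2 μ0 μ1 hq₁ hq₁₂ (by linarith)
  have μl : 0 < μ - lam₁ := by
    have e : (μ - lam₁) * (taup p₁ q₁ - taup p₂ q₁) = (1 - μ) * (taup p₂ q₁ - taup p₅ q₁) := by
      have : lam₂ = 1 - lam₁ := by linarith
      rw [this] at hp₄q₁
      linarith
    have h1 : 0 < (1 - μ) * (taup p₂ q₁ - taup p₅ q₁) := mul_pos μ1 (by linarith)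
    rw [← e] at h1
    exact pos_of_mul_pos_left h1 (by linarith)
  have hAB := three_neg hp₁ hp₁₂ hp₅1 hp₅2 μl μ1 hq₁ hq₁₂ (by
    have : lam₂ = 1 - lam₁ := by linarith
    rw [this] at hp₄q₁
    linarith)
  rw [hlsum, one_mul] at hB
  rw [show μ + (1 - μ) = 1 by ring, one_mul] at hA
  rw [show μ - lam₁ + (1 - μ) = lam₂ by linarith] at hAB
  set A := μ * taup p₁ q₂ + (1 - μ) * taup p₅ q₂ - taup p₄ q₂ with hAdef
  set B := lam₁ * taup p₁ q₂ + lam₂ * taup p₂ q₂ - taup p₄ q₂ with hBdef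
  have hAB' : A < B := by rw [hAdef, hBdef]; linarith
  set s := B / A with hs
  have s0 : 0 < s := div_pos_of_neg_of_neg hB hA
  have s1 : s < 1 := by rw [hs, div_lt_one_of_neg hA]; exact hAB'
  have es : s * A = B := by rw [hs]; exact div_mul_cancel₀ _ hA.ne
  have E1 : s * μ * taup p₁ q₁ + (1 - s) * taup p₄ q₁ + s * (1 - μ) * taup p₅ q₁
      = lam₁ * taup p₁ q₁ + lam₂ * taup p₂ q₁ := by
    rw [← hp₄q₁]; linear_combination s * eμ
  have E2 : s * μ * taup p₁ q₂ + (1 - s) * taup p₄ q₂ + s * (1 - μ) * taup p₅ q₂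
      = lam₁ * taup p₁ q₂ + lam₂ * taup p₂ q₂ := by
    rw [hAdef, hBdef] at es; linear_combination es
  have hs' : 0 < 1 - s := by linarith
  let c : Fin 4 → ℝ := ![s * (1 - μ), -lam₂, 1 - s, s * μ - lam₁]
  let P : Fin 4 → ℝ := ![p₅, p₂, p₄, p₁]
  have hDD : ∀ q, DD c P q = (s * μ * taup p₁ q + (1 - s) * taup p₄ q + s * (1 - μ) * taup p₅ q)
      - (lam₁ * taup p₁ q + lam₂ * taup p₂ q) := by
    intro q
    simp only [DD, Fin.sum_univ_four, c, P]
    simp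
    ring
  have hP : ∀ i, 0 < P i ∧ P i < 1 / 2 := by
    intro i
    fin_cases i <;> simp only [P] <;> constructor <;> simp <;> linarith
  have hanti : StrictAnti P := by
    apply Fin.strictAnti_iff_succ_lt.2
    intro i
    fin_cases i <;> simp [P] <;> linarith
  have hc : c ≠ 0 := by
    intro h
    have := congrFun h 1
    simp [c] at this
    linarith [hl₂.1]
  have hsum : ∑ i, c i = 0 := by
    simp only [Fin.sum_univ_four, c]
    simp
    linarith
  have z1 : DD c P q₁ = 0 := by rw [hDD, E1, sub_self]
  have z2 : DD c P q₂ = 0 := by rw [hDD, E2, sub_self]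
  obtain ⟨d1, d2⟩ := DD_dbl c P hP hanti hc hsum hq₁ hq₁₂ z1 z2
  have dd : ∀ q, deriv (fun q => s * μ * taup p₁ q + (1 - s) * taup p₄ q + s * (1 - μ) * taup p₅ q) q
      = deriv (fun q => lam₁ * taup p₁ q + lam₂ * taup p₂ q) q → HasDerivAt (DD c P) 0 q := by
    intro q h
    have D1 : DifferentiableAt ℝ (taup p₁) q := (taup_deriv hp₁ (by linarith) q).differentiableAt
    have D2 : DifferentiableAt ℝ (taup p₂) q := (taup_deriv (by linarith) hp₂ q).differentiableAt
    have D4 : DifferentiableAt ℝ (taup p₄) q := (taup_deriv (by linarith) (by linarith) q).differentiableAt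
    have D5 : DifferentiableAt ℝ (taup p₅) q := (taup_deriv (by linarith) hp₅2 q).differentiableAt
    have H1 : DifferentiableAt ℝ (fun q => s * μ * taup p₁ q + (1 - s) * taup p₄ q + s * (1 - μ) * taup p₅ q) q := by fun_prop
    have H2 : DifferentiableAt ℝ (fun q => lam₁ * taup p₁ q + lam₂ * taup p₂ q) q := by fun_prop
    have H := H1.hasDerivAt.sub H2.hasDerivAt
    rw [h, sub_self] at H
    have e : DD c P = (fun q => s * μ * taup p₁ q + (1 - s) * taup p₄ q + s * (1 - μ) * taup p₅ q) -
        (fun q => lam₁ * taup p₁ q + lam₂ * taup p₂ q) := by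
      funext q; rw [hDD]; rfl
    rw [e]; exact H
  refine ⟨s * μ, 1 - s, s * (1 - μ), ⟨by positivity, hs', by positivity, by ring, E1, E2⟩, ?_,
    fun h => d1 (dd _ h), fun h => d2 (dd _ h), ?_⟩
  · intro l₃ l₄ l₅ _ _ _ hl e1 e2
    have hl4 : l₄ = 1 - l₃ - l₅ := by linarith
    rw [← hp₄q₁, hl4] at e1
    have k1 : (l₃ - (l₃ + l₅) * μ) * (taup p₁ q₁ - taup p₅ q₁) = 0 := by
      linear_combination e1 - (l₃ + l₅) * eμ
    have k2 : l₃ = (l₃ + l₅) * μ := by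
      have := (mul_eq_zero.1 k1).resolve_right dpos.ne'
      linarith
    have k3 : ((l₃ + l₅) - s) * A = 0 := by
      rw [sub_mul, es, hAdef, hBdef]
      rw [hl4] at e2
      linear_combination e2 + (taup p₅ q₂ - taup p₁ q₂) * k2
    have k4 : l₃ + l₅ = s := by
      have := (mul_eq_zero.1 k3).resolve_right hA.ne
      linarith
    rw [k4] at k2
    refine ⟨k2, by linarith, by linarith⟩
  · intro q hq n1 n2 h
    have z : DD c P q = 0 := by rw [hDD, h, sub_self]
    rcases lt_or_gt_of_ne n1 with h1 | h1
    · exact DD_three c P hP hanti hc hsum hq h1 hq₁₂ z z1 z2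
    · rcases lt_or_gt_of_ne n2 with h2 | h2
      · exact DD_three c P hP hanti hc hsum hq₁ h1 h2 z1 z z2
      · exact DD_three c P hP hanti hc hsum hq₁ hq₁₂ h2 z1 z2 z
end
end
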